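/- arXiv:2312.08135 — 4 statements merged into one kernel-verified Lean document; each statement's English description precedes it below -/
import Mathlib

section
/- Under Assumptions 1 and 2, the Kantorovich problem of minimizing ∫|θ̄(z) − ϑ|² dπ(z,ϑ) over all couplings π ∈ Γ(μ, G*) admits a unique minimizer π*, and π* = (Id × δ*)♯μ for a measurable map δ* : ℝ^d → ℝ^m that is unique up to μ-a.e. equality; moreover this δ* is the μ-a.e. unique minimizer of E_P[|δ(Z) − Θ|²] over all measurable maps δ : ℝ^d → ℝ^m satisfying the pushforward constraint δ♯μ = G*. -/
open MeasureTheory ProbabilityTheory Filter RealInnerProductSpace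
open scoped ENNReal

noncomputable section

/-- Euclidean space `ℝ^n`. -/
abbrev Vec (n : ℕ) := EuclideanSpace ℝ (Fin n)

/-- `π` is a coupling of `ν₁` and `ν₂`: a measure on the product whose marginals are
`ν₁` and `ν₂`. -/
def IsCoupling {X Y : Type*} [MeasurableSpace X] [MeasurableSpace Y]
    (π : Measure (X × Y)) (ν₁ : Measure X) (ν₂ : Measure Y) : Prop :=
  π.map Prod.fst = ν₁ ∧ π.map Prod.snd = ν₂

/-- Squared 2-Wasserstein distance between Borel measures on `ℝ^n`
(as an extended nonnegative real). -/
def W2sq {n : ℕ} (ν₁ ν₂ : Measure (Vec n)) : ℝ≥0∞ :=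
  ⨅ π ∈ {π : Measure (Vec n × Vec n) | IsCoupling π ν₁ ν₂},
    ∫⁻ p, ENNReal.ofReal (‖p.1 - p.2‖ ^ 2) ∂π

/-- `θbar` is a Borel version of the posterior mean `E[Θ | Z]` under the joint law `P`. -/
def IsPosteriorMean {d m : ℕ} (P : Measure (Vec d × Vec m)) (θbar : Vec d → Vec m) : Prop :=
  Measurable θbar ∧
  (fun p => θbar p.1) =ᵐ[P]
    P[(fun p : Vec d × Vec m => p.2) | MeasurableSpace.comap Prod.fst inferInstance]

theorem exists_opt {m : ℕ} (ν G : Measure (Vec m)) [IsProbabilityMeasure ν]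
    [IsProbabilityMeasure G] :
    ∃ γ : Measure (Vec m × Vec m), IsCoupling γ ν G ∧ ∀ π, IsCoupling π ν G →
      ∫⁻ p, ENNReal.ofReal (‖p.1 - p.2‖ ^ 2) ∂γ ≤ ∫⁻ p, ENNReal.ofReal (‖p.1 - p.2‖ ^ 2) ∂π := by
  let S : Set (ProbabilityMeasure (Vec m × Vec m)) := {p | IsCoupling (p : Measure _) ν G}
  let c : ProbabilityMeasure (Vec m × Vec m) → ℝ≥0∞ := fun γ =>
    ∫⁻ p, ENNReal.ofReal (‖p.1 - p.2‖ ^ 2) ∂(γ : Measure (Vec m × Vec m))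
  have hprob : ∀ π, IsCoupling π ν G → IsProbabilityMeasure π := by
    intro π h
    constructor
    have := congrArg (fun μ => μ Set.univ) h.1
    simpa [Measure.map_apply measurable_fst MeasurableSet.univ] using this
  have hSc : IsClosed S := by
    have h1 : IsClosed {p : ProbabilityMeasure (Vec m × Vec m) |
        p.map continuous_fst.measurable.aemeasurable = (⟨ν, inferInstance⟩ : ProbabilityMeasure (Vec m))} :=
      isClosed_eq (ProbabilityMeasure.continuous_map continuous_fst) continuous_const
    have h2 : IsClosed {p : ProbabilityMeasure (Vec m × Vec m) |
        p.map continuous_snd.measurable.aemeasurable = (⟨G, inferInstance⟩ : ProbabilityMeasure (Vec m))} :=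
      isClosed_eq (ProbabilityMeasure.continuous_map continuous_snd) continuous_const
    convert h1.inter h2 using 1
    ext p
    exact and_congr
      ⟨fun h => Subtype.ext h, fun h => congrArg (fun r : ProbabilityMeasure (Vec m) => (r : Measure (Vec m))) h⟩
      ⟨fun h => Subtype.ext h, fun h => congrArg (fun r : ProbabilityMeasure (Vec m) => (r : Measure (Vec m))) h⟩
  have hK : IsCompact S := by
    rw [← hSc.closure_eq]
    apply isCompact_closure_of_isTightMeasureSet
    apply IsTightMeasureSet.prodMk
    · apply (isTightMeasureSet_singleton (μ := ν)).subset
      rintro _ ⟨_, ⟨p, hp, rfl⟩, rfl⟩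
      exact hp.1
    · apply (isTightMeasureSet_singleton (μ := G)).subset
      rintro _ ⟨_, ⟨p, hp, rfl⟩, rfl⟩
      exact hp.2
  have hne : S.Nonempty := by
    refine ⟨⟨ν.prod G, inferInstance⟩, ?_, ?_⟩
    · simp [Measure.map_fst_prod]
    · simp [Measure.map_snd_prod]
  obtain ⟨u, -, hu, hmem⟩ := exists_seq_tendsto_sInf (hne.image c) (OrderBot.bddBelow _)
  choose γ hγ hγu using hmem
  obtain ⟨γ0, hγ0, φ, hφ, hlim⟩ := hK.tendsto_subseq hγ
  refine ⟨γ0, hγ0, fun π hπ => ?_⟩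
  have hle : c γ0 ≤ atTop.liminf (fun i => c (γ (φ i))) := by
    refine lintegral_le_liminf_lintegral_of_forall_isOpen_measure_le_liminf_measure
      (f := fun p : Vec m × Vec m => ‖p.1 - p.2‖ ^ 2) (by fun_prop) (fun p => by positivity) ?_
    intro U hU
    exact ProbabilityMeasure.le_liminf_measure_open_of_tendsto hlim hU
  have hl2 : Tendsto (fun i => c (γ (φ i))) atTop (nhds (sInf (c '' S))) := by
    simp_rw [hγu]
    exact hu.comp hφ.tendsto_atTop
  rw [hl2.liminf_eq] at hle
  have := hprob π hπ
  exact hle.trans (sInf_le ⟨⟨π, inferInstance⟩, hπ, rfl⟩)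

theorem opt_monotone {X : Type*} [MeasurableSpace X] {m : ℕ} (θ : X → Vec m) (hθ : Measurable θ)
    (π : Measure (X × Vec m)) [IsProbabilityMeasure π]
    (hfin : ∫⁻ p, ENNReal.ofReal (‖θ p.1 - p.2‖ ^ 2) ∂π ≠ ⊤)
    (hopt : ∀ π', IsCoupling π' (π.map Prod.fst) (π.map Prod.snd) →
      ∫⁻ p, ENNReal.ofReal (‖θ p.1 - p.2‖ ^ 2) ∂π ≤ ∫⁻ p, ENNReal.ofReal (‖θ p.1 - p.2‖ ^ 2) ∂π') :
    ∀ᵐ w ∂(π.prod π), 0 ≤ ⟪θ w.1.1 - θ w.2.1, w.1.2 - w.2.2⟫ := by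
  classical
  set c : X × Vec m → ℝ≥0∞ := fun p => ENNReal.ofReal (‖θ p.1 - p.2‖ ^ 2) with hc
  have hcm : Measurable c := by
    simp only [hc]
    fun_prop
  let D : Set ((X × Vec m) × (X × Vec m)) := {w | ⟪θ w.1.1 - θ w.2.1, w.1.2 - w.2.2⟫ < 0}
  have hD : MeasurableSet D := measurableSet_lt (by fun_prop) measurable_const
  let S1 : (X × Vec m) × (X × Vec m) → X × Vec m := fun w => if w ∈ D then (w.1.1, w.2.2) else w.1
  let S2 : (X × Vec m) × (X × Vec m) → X × Vec m := fun w => if w ∈ D then (w.2.1, w.1.2) else w.2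
  have hS1 : Measurable S1 := Measurable.ite hD (by fun_prop) (by fun_prop)
  have hS2 : Measurable S2 := Measurable.ite hD (by fun_prop) (by fun_prop)
  set Q := π.prod π with hQ
  have hQ1 : Q.map Prod.fst = π := by simp [hQ, Measure.map_fst_prod]
  have hQ2 : Q.map Prod.snd = π := by simp [hQ, Measure.map_snd_prod]
  have half : ∀ ρ : Measure X, (1/2 : ℝ≥0∞) • (ρ + ρ) = ρ := by
    intro ρ
    rw [← two_smul ℝ≥0∞ ρ, smul_smul, one_div, ENNReal.inv_mul_cancel (by simp) (by simp), one_smul]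
  have half' : ∀ ρ : Measure (Vec m), (1/2 : ℝ≥0∞) • (ρ + ρ) = ρ := by
    intro ρ
    rw [← two_smul ℝ≥0∞ ρ, smul_smul, one_div, ENNReal.inv_mul_cancel (by simp) (by simp), one_smul]
  let π' : Measure (X × Vec m) := (1/2 : ℝ≥0∞) • (Q.map S1 + Q.map S2)
  have hcoup : IsCoupling π' (π.map Prod.fst) (π.map Prod.snd) := by
    constructor
    · simp only [π']
      rw [Measure.map_smul, Measure.map_add _ _ measurable_fst, Measure.map_map measurable_fst hS1,
        Measure.map_map measurable_fst hS2]
      have e1 : Prod.fst ∘ S1 = Prod.fst ∘ Prod.fst := by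
        ext w; simp only [S1, Function.comp]; split_ifs <;> rfl
      have e2 : Prod.fst ∘ S2 = Prod.fst ∘ Prod.snd := by
        ext w; simp only [S2, Function.comp]; split_ifs <;> rfl
      rw [e1, e2, ← Measure.map_map measurable_fst measurable_fst,
        ← Measure.map_map measurable_fst measurable_snd, hQ1, hQ2, half]
    · simp only [π']
      rw [Measure.map_smul, Measure.map_add _ _ measurable_snd, Measure.map_map measurable_snd hS1,
        Measure.map_map measurable_snd hS2]
      rw [← half' (π.map Prod.snd)]
      congr 1
      have e1 : π.map Prod.snd = Q.map (Prod.snd ∘ Prod.fst) := by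
        rw [← Measure.map_map measurable_snd measurable_fst, hQ1]
      have e2 : π.map Prod.snd = Q.map (Prod.snd ∘ Prod.snd) := by
        rw [← Measure.map_map measurable_snd measurable_snd, hQ2]
      have e3 : π.map Prod.snd + π.map Prod.snd =
          Q.map (Prod.snd ∘ Prod.fst) + Q.map (Prod.snd ∘ Prod.snd) := by rw [← e1, ← e2]
      rw [e3]
      refine Measure.ext_of_lintegral _ fun f hf => ?_
      rw [lintegral_add_measure, lintegral_add_measure,
        lintegral_map hf (measurable_snd.comp hS1), lintegral_map hf (measurable_snd.comp hS2),
        lintegral_map hf (by fun_prop), lintegral_map hf (by fun_prop),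
        ← lintegral_add_left (f := fun w => f ((Prod.snd ∘ S1) w)) (hf.comp (measurable_snd.comp hS1)),
        ← lintegral_add_left (f := fun w => f ((Prod.snd ∘ Prod.fst) w)) (hf.comp (by fun_prop))]
      refine lintegral_congr fun w => ?_
      simp only [S1, S2, Function.comp]
      split_ifs
      · exact add_comm _ _
      · rfl
  have hle := hopt π' hcoup
  have hreal : ∀ (a b x y : Vec m), ‖a - y‖ ^ 2 + ‖b - x‖ ^ 2 =
      ‖a - x‖ ^ 2 + ‖b - y‖ ^ 2 + 2 * ⟪a - b, x - y⟫ := by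
    intro a b x y
    simp only [← real_inner_self_eq_norm_sq, inner_sub_left, inner_sub_right]
    simp only [real_inner_comm]
    ring
  have hpt : ∀ w, c (S1 w) + c (S2 w) ≤ c w.1 + c w.2 := by
    intro w
    by_cases hw : w ∈ D
    · simp only [S1, S2, hw, if_true, hc]
      rw [← ENNReal.ofReal_add (by positivity) (by positivity),
        ← ENNReal.ofReal_add (by positivity) (by positivity)]
      apply ENNReal.ofReal_le_ofReal
      rw [hreal]
      have : ⟪θ w.1.1 - θ w.2.1, w.1.2 - w.2.2⟫ < 0 := hw
      linarith
    · simp [S1, S2, hw]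
  have hI : ∫⁻ w, (c w.1 + c w.2) ∂Q = 2 * ∫⁻ p, c p ∂π := by
    rw [lintegral_add_left (by fun_prop), two_mul]
    congr 1
    · rw [← lintegral_map hcm measurable_fst, hQ1]
    · rw [← lintegral_map hcm measurable_snd, hQ2]
  have hI' : ∫⁻ p, c p ∂π' = (1/2) * ∫⁻ w, (c (S1 w) + c (S2 w)) ∂Q := by
    simp only [π']
    rw [lintegral_smul_measure, lintegral_add_measure, lintegral_map hcm hS1, lintegral_map hcm hS2,
      ← lintegral_add_left (f := fun w => c (S1 w)) (hcm.comp hS1)]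
    rfl
  have hge : ∫⁻ w, (c w.1 + c w.2) ∂Q ≤ ∫⁻ w, (c (S1 w) + c (S2 w)) ∂Q := by
    rw [hI]
    calc 2 * ∫⁻ p, c p ∂π ≤ 2 * ∫⁻ p, c p ∂π' := by gcongr
      _ = _ := by
        rw [hI', ← mul_assoc, one_div, ENNReal.mul_inv_cancel (by simp) (by simp), one_mul]
  have hae := ae_eq_of_ae_le_of_lintegral_le (Eventually.of_forall hpt)
    (ne_top_of_le_ne_top (by rw [hI]; exact ENNReal.mul_ne_top (by simp) hfin)
      (lintegral_mono hpt)) (by fun_prop) hge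
  filter_upwards [hae] with w hw
  by_contra hneg
  have hwD : w ∈ D := not_le.mp hneg
  simp only [S1, S2, hwD, if_true, hc] at hw
  rw [← ENNReal.ofReal_add (by positivity) (by positivity),
        ← ENNReal.ofReal_add (by positivity) (by positivity),
        ENNReal.ofReal_eq_ofReal_iff (by positivity) (by positivity), hreal] at hw
  linarith

theorem cone_null {m : ℕ} (A : Set (Vec m)) (v : Vec m) (e : ℝ) (he0 : 0 ≤ e) (he : e < ‖v‖)
    (h : ∀ x ∈ A, ∀ y ∈ A, ⟪x - y, v⟫ ≤ e * ‖x - y‖) : volume A = 0 := by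
  have hcl : ∀ x ∈ closure A, ∀ y ∈ closure A, ⟪x - y, v⟫ ≤ e * ‖x - y‖ := by
    intro x hx y hy
    have hmem : (x, y) ∈ closure (A ×ˢ A) := by rw [closure_prod_eq]; exact ⟨hx, hy⟩
    have hC : IsClosed {p : Vec m × Vec m | ⟪p.1 - p.2, v⟫ ≤ e * ‖p.1 - p.2‖} :=
      isClosed_le (by fun_prop) (by fun_prop)
    exact closure_minimal (fun p hp => h _ hp.1 _ hp.2) hC hmem
  have hvpos : 0 < ‖v‖ := he0.trans_lt he
  refine measure_mono_null subset_closure ?_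
  refine Measure.addHaar_eq_zero_of_disjoint_translates volume
    (fun n : ℕ => ((1 : ℝ) / (n + 1)) • v) ?_ ?_ isClosed_closure.measurableSet
  · refine (Metric.isBounded_closedBall (x := (0 : Vec m)) (r := ‖v‖)).subset ?_
    rintro _ ⟨n, rfl⟩
    simp only [mem_closedBall_zero_iff, norm_smul]
    have : ‖(1 : ℝ) / (n + 1)‖ ≤ 1 := by
      rw [Real.norm_of_nonneg (by positivity)]
      rw [div_le_one (by positivity)]
      linarith [(Nat.cast_nonneg n : (0:ℝ) ≤ n)]
    nlinarith
  · have key : ∀ s t : ℝ, s < t → ∀ x ∈ closure A, ∀ y ∈ closure A, s • v + x ≠ t • v + y := by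
      intro s t hst x hx y hy hxy
      have e1 : x - y = (t - s) • v := by
        rw [sub_smul]; exact sub_eq_sub_iff_add_eq_add.mpr (by rw [add_comm, hxy])
      have := hcl x hx y hy
      rw [e1, real_inner_smul_left, norm_smul, real_inner_self_eq_norm_sq,
        Real.norm_of_nonneg (by linarith)] at this
      have h2 : 0 < (t - s) * ‖v‖ := mul_pos (by linarith) hvpos
      nlinarith
    intro i j hij
    rw [Function.onFun, Set.disjoint_left]
    rintro z ⟨_, rfl, x, hx, rfl⟩ ⟨_, rfl, y, hy, hxy⟩
    have hne : (1 : ℝ) / (i + 1) ≠ 1 / (j + 1) := by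
      intro h
      rw [div_eq_div_iff (by positivity) (by positivity)] at h
      apply hij
      have : (i : ℝ) = j := by linarith
      exact_mod_cast this
    rcases lt_or_gt_of_ne hne with hl | hl
    · exact key _ _ hl x hx y hy hxy.symm
    · exact key _ _ hl y hy x hx hxy

theorem monotone_single {m : ℕ} (M : Set (Vec m × Vec m))
    (hM : ∀ p ∈ M, ∀ q ∈ M, 0 ≤ ⟪p.1 - q.1, p.2 - q.2⟫) :
    volume {x : Vec m | ∃ y z, y ≠ z ∧ (x, y) ∈ M ∧ (x, z) ∈ M} = 0 := by
  obtain ⟨s, hsc, hsd⟩ := TopologicalSpace.exists_countable_dense (Vec m)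
  let A : Vec m → Vec m → ℕ → Set (Vec m) := fun a b k =>
    {x | ∃ y z, (x, y) ∈ M ∧ (x, z) ∈ M ∧ ‖y - a‖ < 1 / (k + 1) ∧ ‖z - b‖ < 1 / (k + 1) ∧
      2 * (1 / ((k : ℝ) + 1)) < ‖b - a‖}
  have hA : ∀ a b k, volume (A a b k) = 0 := by
    intro a b k
    by_cases hab : 2 * (1 / ((k : ℝ) + 1)) < ‖b - a‖
    · refine cone_null _ (b - a) _ (by positivity) hab ?_
      rintro x ⟨y, z, hy, hz, hya, hzb, -⟩ x' ⟨y', z', hy', hz', hya', hzb', -⟩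
      have h1 := hM _ hy _ hz'
      simp only at h1
      have e : b - a = (y - a) - (z' - b) - (y - z') := by abel
      rw [e, inner_sub_right, inner_sub_right]
      have h2 := real_inner_le_norm (x - x') (y - a)
      have h3 := neg_le_of_abs_le (abs_real_inner_le_norm (x - x') (z' - b))
      have h4 := norm_nonneg (x - x')
      nlinarith
    · have : A a b k = ∅ := by
        ext x
        simp only [A, Set.mem_ofPred_eq, Set.mem_empty_iff_false, iff_false]
        rintro ⟨y, z, -, -, -, -, h⟩
        exact hab h
      rw [this, measure_empty]
  have hU : volume (⋃ a ∈ s, ⋃ b ∈ s, ⋃ k : ℕ, A a b k) = 0 := by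
    rw [measure_biUnion_null_iff hsc]
    intro a _
    rw [measure_biUnion_null_iff hsc]
    intro b _
    exact measure_iUnion_null fun k => hA a b k
  refine measure_mono_null ?_ hU
  rintro x ⟨y, z, hne, hy, hz⟩
  have hpos : 0 < ‖z - y‖ := norm_pos_iff.mpr (sub_ne_zero.mpr hne.symm)
  obtain ⟨k, hk⟩ := exists_nat_one_div_lt (show 0 < ‖z - y‖ / 4 by positivity)
  have hk0 : 0 < 1 / ((k : ℝ) + 1) := by positivity
  obtain ⟨a, ha, has⟩ := Metric.dense_iff.mp hsd y _ hk0
  obtain ⟨b, hb, hbs⟩ := Metric.dense_iff.mp hsd z _ hk0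
  rw [Metric.mem_ball, dist_comm, dist_eq_norm] at ha hb
  simp only [Set.mem_iUnion]
  refine ⟨a, has, b, hbs, k, y, z, hy, hz, ha, hb, ?_⟩
  have : ‖z - y‖ ≤ ‖z - b‖ + ‖b - a‖ + ‖y - a‖ := by
    have e : z - y = (z - b) + (b - a) - (y - a) := by abel
    rw [e]
    exact (norm_sub_le _ _).trans (by gcongr; exact norm_add_le _ _)
  linarith

theorem graph_of_monotone {m : ℕ} (γ : Measure (Vec m × Vec m)) [IsProbabilityMeasure γ]
    (hac : γ.map Prod.fst ≪ volume)
    (hmon : ∀ᵐ w ∂(γ.prod γ), 0 ≤ ⟪w.1.1 - w.2.1, w.1.2 - w.2.2⟫) :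
    ∃ T : Vec m → Vec m, Measurable T ∧ ∀ᵐ p ∂γ, p.2 = T p.1 := by
  have hM : ∀ p ∈ γ.support, ∀ q ∈ γ.support, 0 ≤ ⟪p.1 - q.1, p.2 - q.2⟫ := by
    intro p hp q hq
    by_contra hneg
    rw [not_le] at hneg
    have hO : IsOpen {w : (Vec m × Vec m) × (Vec m × Vec m) |
        ⟪w.1.1 - w.2.1, w.1.2 - w.2.2⟫ < 0} := isOpen_lt (by fun_prop) continuous_const
    have hn := hO.mem_nhds (show (p, q) ∈ _ from hneg)
    rw [mem_nhds_prod_iff] at hn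
    obtain ⟨U, hU, V, hV, hUV⟩ := hn
    have h1 := (Measure.mem_support_iff_forall p).mp hp U hU
    have h2 := (Measure.mem_support_iff_forall q).mp hq V hV
    have h3 : (γ.prod γ) (U ×ˢ V) = 0 := by
      refine measure_mono_null hUV ?_
      rw [ae_iff] at hmon
      simpa only [not_le] using hmon
    rw [Measure.prod_prod, mul_eq_zero] at h3
    rcases h3 with h3 | h3
    · exact h1.ne' h3
    · exact h2.ne' h3
  have hN := hac (monotone_single γ.support hM)
  let κ := γ.condKernel
  have hdis : γ.fst ⊗ₘ κ = γ := γ.disintegrate κ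
  let T : Vec m → Vec m := fun x => ∫ y, y ∂(κ x)
  have hT : Measurable T := by
    have : StronglyMeasurable (fun x => ∫ y, (fun p : Vec m × Vec m => p.2) (x, y) ∂(κ x)) :=
      StronglyMeasurable.integral_kernel_prod_right' measurable_snd.stronglyMeasurable
    exact this.measurable
  refine ⟨T, hT, ?_⟩
  have hs : ∀ᵐ p ∂γ, p ∈ γ.support := Measure.support_mem_ae
  rw [← hdis] at hs
  have hs' := Measure.ae_ae_of_ae_compProd hs
  rw [hdis] at hs'
  have hme : MeasurableSet {p : Vec m × Vec m | p.2 = T p.1} :=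
    measurableSet_eq_fun measurable_snd (hT.comp measurable_fst)
  have : ∀ᵐ p ∂(γ.fst ⊗ₘ κ), p.2 = T p.1 := by
    rw [Measure.ae_compProd_iff hme]
    have hN' : ∀ᵐ x ∂γ.fst, ¬ ∃ y z, y ≠ z ∧ (x, y) ∈ γ.support ∧ (x, z) ∈ γ.support := by
      rw [ae_iff]; simp only [not_not]; exact hN
    filter_upwards [hs', hN'] with x hx hx'
    obtain ⟨y0, hy0⟩ := hx.exists
    have hall : ∀ᵐ y ∂(κ x), y = y0 := by
      filter_upwards [hx] with y hy
      by_contra hne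
      exact hx' ⟨y, y0, hne, hy, hy0⟩
    have hTx : T x = y0 := by
      simp only [T]
      rw [integral_congr_ae hall]
      simp
    filter_upwards [hall] with y hy
    rw [hTx]; exact hy
  rwa [hdis] at this

theorem opt_graph {X : Type*} [MeasurableSpace X] {m : ℕ} (θ : X → Vec m) (hθ : Measurable θ)
    (π : Measure (X × Vec m)) [IsProbabilityMeasure π]
    (hfin : ∫⁻ p, ENNReal.ofReal (‖θ p.1 - p.2‖ ^ 2) ∂π ≠ ⊤)
    (hopt : ∀ π', IsCoupling π' (π.map Prod.fst) (π.map Prod.snd) →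
      ∫⁻ p, ENNReal.ofReal (‖θ p.1 - p.2‖ ^ 2) ∂π ≤ ∫⁻ p, ENNReal.ofReal (‖θ p.1 - p.2‖ ^ 2) ∂π')
    (hac : (π.map Prod.fst).map θ ≪ volume) :
    ∃ T : Vec m → Vec m, Measurable T ∧ ∀ᵐ p ∂π, p.2 = T (θ p.1) := by
  have hmon := opt_monotone θ hθ π hfin hopt
  let F : X × Vec m → Vec m × Vec m := Prod.map θ id
  have hF : Measurable F := hθ.prodMap measurable_id
  have : IsProbabilityMeasure (π.map F) := Measure.isProbabilityMeasure_map hF.aemeasurable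
  have h1 : (π.map F).map Prod.fst ≪ volume := by
    rw [Measure.map_map measurable_fst hF]
    rw [Measure.map_map hθ measurable_fst] at hac
    exact hac
  have h2 : ∀ᵐ w ∂((π.map F).prod (π.map F)), 0 ≤ ⟪w.1.1 - w.2.1, w.1.2 - w.2.2⟫ := by
    rw [Measure.map_prod_map _ _ hF hF, ae_map_iff (by fun_prop)
      (measurableSet_le measurable_const (by fun_prop))]
    exact hmon
  obtain ⟨T, hT, h⟩ := graph_of_monotone _ h1 h2
  refine ⟨T, hT, ?_⟩
  exact (ae_map_iff hF.aemeasurable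
    (measurableSet_eq_fun measurable_snd (hT.comp measurable_fst))).mp h


theorem ae_eq_of_graph_eq {d m : ℕ} (μ : Measure (Vec d)) (f g : Vec d → Vec m)
    (hf : Measurable f) (hg : Measurable g)
    (h : (μ.map fun z => (z, f z)) = (μ.map fun z => (z, g z))) : f =ᵐ[μ] g := by
  have hme : MeasurableSet {p : Vec d × Vec m | p.2 = g p.1} :=
    measurableSet_eq_fun measurable_snd (hg.comp measurable_fst)
  have h1 : ∀ᵐ p ∂(μ.map fun z => (z, g z)), p.2 = g p.1 :=
    (ae_map_iff (by fun_prop) hme).mpr (Eventually.of_forall fun z => rfl)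
  rw [← h] at h1
  exact (ae_map_iff (by fun_prop) hme).mp h1

theorem eq_graph {d m : ℕ} (π : Measure (Vec d × Vec m)) (g : Vec d → Vec m) (hg : Measurable g)
    (h : ∀ᵐ p ∂π, p.2 = g p.1) : π = (π.map Prod.fst).map fun z => (z, g z) := by
  rw [Measure.map_map (by fun_prop) measurable_fst]
  conv_lhs => rw [← Measure.map_id (μ := π)]
  refine Measure.map_congr ?_
  filter_upwards [h] with p hp
  exact Prod.ext rfl hp

theorem memLp_iff_fin {Ω : Type*} [MeasurableSpace Ω] {m : ℕ} (μ : Measure Ω) (f : Ω → Vec m)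
    (hf : AEStronglyMeasurable f μ) :
    MemLp f 2 μ ↔ ∫⁻ x, ENNReal.ofReal (‖f x‖ ^ 2) ∂μ < ⊤ := by
  rw [memLp_two_iff_integrable_sq_norm hf]
  constructor
  · intro h
    exact h.lintegral_lt_top
  · intro h
    refine ⟨by fun_prop, ?_⟩
    rw [hasFiniteIntegral_iff_ofReal (Eventually.of_forall fun x => by positivity)]
    exact h

theorem memLp_inner {Ω : Type*} [MeasurableSpace Ω] {m : ℕ} (μ : Measure Ω) {f g : Ω → Vec m}
    (hf : MemLp f 2 μ) (hg : MemLp g 2 μ) : Integrable (fun x => ⟪f x, g x⟫) μ := by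
  refine Integrable.mono (hf.norm.integrable_mul hg.norm)
    (hf.aestronglyMeasurable.inner hg.aestronglyMeasurable) (Eventually.of_forall fun x => ?_)
  simp only [Pi.mul_apply, norm_mul, norm_norm]
  exact norm_inner_le_norm _ _

theorem bayes_decomp {d m : ℕ}
    (P : Measure (Vec d × Vec m)) [IsProbabilityMeasure P]
    (θbar : Vec d → Vec m) (hθbar : IsPosteriorMean P θbar)
    (hP2 : MemLp (fun p : Vec d × Vec m => p.2) 2 P)
    (δ : Vec d → Vec m) (hδ : Measurable δ) (hδ2 : MemLp (fun p : Vec d × Vec m => δ p.1) 2 P) :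
    ∫⁻ p, ENNReal.ofReal (‖δ p.1 - p.2‖ ^ 2) ∂P =
      ∫⁻ p, ENNReal.ofReal (‖θbar p.1 - δ p.1‖ ^ 2) ∂P +
      ∫⁻ p, ENNReal.ofReal (‖θbar p.1 - p.2‖ ^ 2) ∂P := by
  have hm : MeasurableSpace.comap (Prod.fst : Vec d × Vec m → Vec d) inferInstance ≤
      (inferInstance : MeasurableSpace (Vec d × Vec m)) := measurable_fst.comap_le
  have hθ2 : MemLp (fun p : Vec d × Vec m => θbar p.1) 2 P :=
    (memLp_congr_ae hθbar.2).mpr (hP2.condExp (by norm_num))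
  have hθm := hθbar.1
  have hsm : StronglyMeasurable[MeasurableSpace.comap (Prod.fst : Vec d × Vec m → Vec d) inferInstance]
      (fun p : Vec d × Vec m => δ p.1 - θbar p.1) :=
    ((hδ.sub hθm).comp (comap_measurable Prod.fst)).stronglyMeasurable
  have hA : MemLp (fun p : Vec d × Vec m => δ p.1 - θbar p.1) 2 P := hδ2.sub hθ2
  have hB : MemLp (fun p : Vec d × Vec m => θbar p.1 - p.2) 2 P := hθ2.sub hP2
  have i1 : Integrable (fun p : Vec d × Vec m => ⟪δ p.1 - θbar p.1, p.2⟫) P := memLp_inner P hA hP2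
  have i2 : Integrable (fun p : Vec d × Vec m => ⟪δ p.1 - θbar p.1, θbar p.1⟫) P :=
    memLp_inner P hA hθ2
  have h0 : ∫ p, ⟪δ p.1 - θbar p.1, p.2⟫ ∂P = ∫ p, ⟪δ p.1 - θbar p.1, θbar p.1⟫ ∂P := by
    have hpull := condExp_bilin_of_stronglyMeasurable_left (μ := P) (innerSL ℝ (E := Vec m)) hsm
      (g := fun p : Vec d × Vec m => p.2) i1 (hP2.integrable (by norm_num))
    rw [← integral_condExp hm]
    refine integral_congr_ae (hpull.trans ?_)
    filter_upwards [hθbar.2] with p hp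
    rw [hp]; rfl
  have iA : Integrable (fun p : Vec d × Vec m => ‖θbar p.1 - δ p.1‖ ^ 2) P := by
    simpa only [norm_sub_rev] using hA.integrable_norm_pow (p := 2) (by norm_num)
  have iB : Integrable (fun p : Vec d × Vec m => ‖θbar p.1 - p.2‖ ^ 2) P :=
    hB.integrable_norm_pow (p := 2) (by norm_num)
  have iC : Integrable (fun p : Vec d × Vec m => ‖δ p.1 - p.2‖ ^ 2) P :=
    (hδ2.sub hP2).integrable_norm_pow (p := 2) (by norm_num)
  have hn : ∀ f : Vec d × Vec m → Vec m, 0 ≤ᵐ[P] fun p => ‖f p‖ ^ 2 :=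
    fun f => Eventually.of_forall fun p => by positivity
  rw [← ofReal_integral_eq_lintegral_ofReal iA (hn _), ← ofReal_integral_eq_lintegral_ofReal iB (hn _),
    ← ofReal_integral_eq_lintegral_ofReal iC (hn _), ← ENNReal.ofReal_add
      (integral_nonneg fun p => by positivity) (integral_nonneg fun p => by positivity)]
  congr 1
  have e : ∀ p : Vec d × Vec m, ‖δ p.1 - p.2‖ ^ 2 = (‖θbar p.1 - δ p.1‖ ^ 2 + ‖θbar p.1 - p.2‖ ^ 2) +
      2 * (⟪δ p.1 - θbar p.1, θbar p.1⟫ - ⟪δ p.1 - θbar p.1, p.2⟫) := by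
    intro p
    simp only [← real_inner_self_eq_norm_sq, inner_sub_left, inner_sub_right]
    rw [real_inner_comm (δ p.1) (θbar p.1), real_inner_comm (δ p.1) p.2,
      real_inner_comm (θbar p.1) p.2]
    ring
  simp_rw [e]
  have s1 := integral_add (iA.add iB) ((i2.sub i1).const_mul 2)
  have s2 := integral_add iA iB
  have s3 := integral_sub i2 i1
  simp only [Pi.add_apply, Pi.sub_apply] at s1
  rw [s1, s2, integral_const_mul, s3, h0]
  ring


/-- Under Assumptions 1 and 2, the Kantorovich problem of minimizing
`∫ ‖θ̄(z) − ϑ‖² dπ` over couplings `π ∈ Γ(μ, G*)` admits a unique minimizer `π*`, which is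
of the form `(Id × δ*)♯μ` for a measurable map `δ*` unique up to `μ`-a.e. equality; moreover
`δ*` is the `μ`-a.e. unique minimizer of `E_P[‖δ(Z) − Θ‖²]` over measurable maps `δ` with
`δ♯μ = G*`. -/
theorem stmt0 {d m : ℕ}
    (P : Measure (Vec d × Vec m)) [IsProbabilityMeasure P]
    (μ : Measure (Vec d)) (G : Measure (Vec m))
    (hμ : μ = P.map Prod.fst) (hG : G = P.map Prod.snd)
    (θbar : Vec d → Vec m) (hθbar : IsPosteriorMean P θbar)
    -- Assumption 1 : `G*` has finite second moment
    (hA1 : ∫⁻ θ, ENNReal.ofReal (‖θ‖ ^ 2) ∂G < ⊤)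
    -- Assumption 2 : `θ̄♯μ` is absolutely continuous w.r.t. Lebesgue measure on `ℝ^m`
    (hA2 : (μ.map θbar) ≪ (volume : Measure (Vec m))) :
    ∃ δstar : Vec d → Vec m,
      Measurable δstar ∧
      μ.map δstar = G ∧
      -- `(Id × δ*)♯μ` minimizes the Kantorovich problem …
      (∀ π : Measure (Vec d × Vec m), IsCoupling π μ G →
        ∫⁻ p, ENNReal.ofReal (‖θbar p.1 - p.2‖ ^ 2) ∂(μ.map fun z => (z, δstar z)) ≤
          ∫⁻ p, ENNReal.ofReal (‖θbar p.1 - p.2‖ ^ 2) ∂π) ∧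
      -- … and is its unique minimizer
      (∀ π : Measure (Vec d × Vec m), IsCoupling π μ G →
        (∫⁻ p, ENNReal.ofReal (‖θbar p.1 - p.2‖ ^ 2) ∂π =
          ∫⁻ p, ENNReal.ofReal (‖θbar p.1 - p.2‖ ^ 2) ∂(μ.map fun z => (z, δstar z))) →
        π = μ.map fun z => (z, δstar z)) ∧
      -- the representing map is unique up to `μ`-a.e. equality
      (∀ δ' : Vec d → Vec m, Measurable δ' →
        (μ.map fun z => (z, δ' z)) = (μ.map fun z => (z, δstar z)) →
        δ' =ᵐ[μ] δstar) ∧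
      -- `δ*` minimizes the constrained Bayes risk …
      (∀ δ : Vec d → Vec m, Measurable δ → μ.map δ = G →
        ∫⁻ p, ENNReal.ofReal (‖δstar p.1 - p.2‖ ^ 2) ∂P ≤
          ∫⁻ p, ENNReal.ofReal (‖δ p.1 - p.2‖ ^ 2) ∂P) ∧
      -- … and is its `μ`-a.e. unique minimizer
      (∀ δ : Vec d → Vec m, Measurable δ → μ.map δ = G →
        (∫⁻ p, ENNReal.ofReal (‖δ p.1 - p.2‖ ^ 2) ∂P =
          ∫⁻ p, ENNReal.ofReal (‖δstar p.1 - p.2‖ ^ 2) ∂P) →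
        δ =ᵐ[μ] δstar) := by
  subst hμ hG
  set μ := P.map Prod.fst with hμ
  set G := P.map Prod.snd with hG
  have hθm := hθbar.1
  have : IsProbabilityMeasure μ := Measure.isProbabilityMeasure_map measurable_fst.aemeasurable
  have : IsProbabilityMeasure G := Measure.isProbabilityMeasure_map measurable_snd.aemeasurable
  have : IsProbabilityMeasure (μ.map θbar) := Measure.isProbabilityMeasure_map hθm.aemeasurable
  have hcm : Measurable fun p : Vec d × Vec m => ENNReal.ofReal (‖θbar p.1 - p.2‖ ^ 2) := by fun_prop
  have hcm' : Measurable fun p : Vec m × Vec m => ENNReal.ofReal (‖p.1 - p.2‖ ^ 2) := by fun_prop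
  have hGL : MemLp (fun x : Vec m => x) 2 G :=
    (memLp_iff_fin G (fun x => x) measurable_id.aestronglyMeasurable).mpr hA1
  have hP2 : MemLp (fun p : Vec d × Vec m => p.2) 2 P :=
    hGL.comp_of_map measurable_snd.aemeasurable
  have hθ2 : MemLp (fun p : Vec d × Vec m => θbar p.1) 2 P :=
    (memLp_congr_ae hθbar.2).mpr (hP2.condExp (by norm_num))
  have hPfin : ∫⁻ p, ENNReal.ofReal (‖θbar p.1 - p.2‖ ^ 2) ∂P < ⊤ :=
    (memLp_iff_fin P (fun p => θbar p.1 - p.2) (by fun_prop)).mp (hθ2.sub hP2)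
  have hprob : ∀ π, IsCoupling π μ G → IsProbabilityMeasure π := by
    intro π h
    constructor
    have := congrArg (fun μ => μ Set.univ) h.1
    simpa [Measure.map_apply measurable_fst MeasurableSet.univ] using this
  -- optimal coupling on the image side
  obtain ⟨γ, hγ, hγopt⟩ := exists_opt (μ.map θbar) G
  have : IsProbabilityMeasure γ := by
    constructor
    have := congrArg (fun μ => μ Set.univ) hγ.1
    rw [Measure.map_apply measurable_fst MeasurableSet.univ] at this
    simpa using this
  have hF : Measurable (Prod.map θbar id : Vec d × Vec m → Vec m × Vec m) :=
    hθm.prodMap measurable_id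
  have hpush : ∀ π, IsCoupling π μ G → IsCoupling (π.map (Prod.map θbar id)) (μ.map θbar) G := by
    intro π h
    constructor
    · rw [Measure.map_map measurable_fst hF, ← h.1, Measure.map_map hθm measurable_fst]
      rfl
    · rw [Measure.map_map measurable_snd hF, ← h.2]
      rfl
  have hlow : ∀ π, IsCoupling π μ G → ∫⁻ p, ENNReal.ofReal (‖p.1 - p.2‖ ^ 2) ∂γ ≤
      ∫⁻ p, ENNReal.ofReal (‖θbar p.1 - p.2‖ ^ 2) ∂π := by
    intro π h
    refine (hγopt _ (hpush π h)).trans_eq ?_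
    rw [lintegral_map hcm' hF]
    rfl
  have hγfin : ∫⁻ p, ENNReal.ofReal (‖p.1 - p.2‖ ^ 2) ∂γ ≠ ⊤ :=
    ((hlow P ⟨rfl, rfl⟩).trans_lt hPfin).ne
  obtain ⟨T, hT, hγT⟩ := opt_graph (id : Vec m → Vec m) measurable_id γ hγfin
    (fun π' h => hγopt π' (by rwa [hγ.1, hγ.2] at h))
    (by rw [hγ.1, Measure.map_id]; exact hA2)
  have hγeq := eq_graph γ T hT hγT
  rw [hγ.1] at hγeq
  have hδm : Measurable fun z => T (θbar z) := hT.comp hθm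
  have hδG : μ.map (fun z => T (θbar z)) = G := by
    have h1 := hγ.2
    rw [hγeq, Measure.map_map measurable_snd (by fun_prop), Measure.map_map (by fun_prop) hθm] at h1
    exact h1
  have hgr : ∀ δ : Vec d → Vec m, Measurable δ → μ.map δ = G →
      IsCoupling (μ.map fun z => (z, δ z)) μ G := by
    intro δ hδ hδG
    constructor
    · rw [Measure.map_map measurable_fst (by fun_prop)]
      exact Measure.map_id
    · rw [Measure.map_map measurable_snd (by fun_prop)]
      exact hδG
  have hcost : ∫⁻ p, ENNReal.ofReal (‖θbar p.1 - p.2‖ ^ 2) ∂(μ.map fun z => (z, T (θbar z))) =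
      ∫⁻ p, ENNReal.ofReal (‖p.1 - p.2‖ ^ 2) ∂γ := by
    rw [hγeq, lintegral_map hcm (by fun_prop), lintegral_map hcm' (by fun_prop),
      lintegral_map (by fun_prop) hθm]
  have hopt : ∀ π : Measure (Vec d × Vec m), IsCoupling π μ G →
        ∫⁻ p, ENNReal.ofReal (‖θbar p.1 - p.2‖ ^ 2) ∂(μ.map fun z => (z, T (θbar z))) ≤
          ∫⁻ p, ENNReal.ofReal (‖θbar p.1 - p.2‖ ^ 2) ∂π := by
    intro π h
    rw [hcost]
    exact hlow π h
  have half : ∀ a : ℝ≥0∞, (1/2 : ℝ≥0∞) * (a + a) = a := by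
    intro a
    rw [← two_mul, ← mul_assoc, one_div, ENNReal.inv_mul_cancel (by simp) (by simp), one_mul]
  have huniq : ∀ π : Measure (Vec d × Vec m), IsCoupling π μ G →
        (∫⁻ p, ENNReal.ofReal (‖θbar p.1 - p.2‖ ^ 2) ∂π =
          ∫⁻ p, ENNReal.ofReal (‖θbar p.1 - p.2‖ ^ 2) ∂(μ.map fun z => (z, T (θbar z)))) →
        π = μ.map fun z => (z, T (θbar z)) := by
    intro π h heq
    set πs := μ.map fun z => (z, T (θbar z)) with hπs
    have hs : IsCoupling πs μ G := hgr _ hδm hδG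
    let ρ : Measure (Vec d × Vec m) := (1/2 : ℝ≥0∞) • (π + πs)
    have hρ : IsCoupling ρ μ G := by
      constructor
      · simp only [ρ]
        rw [Measure.map_smul, Measure.map_add _ _ measurable_fst, h.1, hs.1]
        ext s _
        simpa [mul_add] using half (μ s)
      · simp only [ρ]
        rw [Measure.map_smul, Measure.map_add _ _ measurable_snd, h.2, hs.2]
        ext s _
        simpa [mul_add] using half (G s)
    have := hprob ρ hρ
    have hρc : ∫⁻ p, ENNReal.ofReal (‖θbar p.1 - p.2‖ ^ 2) ∂ρ =
        ∫⁻ p, ENNReal.ofReal (‖θbar p.1 - p.2‖ ^ 2) ∂πs := by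
      simp only [ρ]
      rw [lintegral_smul_measure, lintegral_add_measure, heq]
      exact half _
    obtain ⟨T', hT', hρT⟩ := opt_graph θbar hθm ρ (by rw [hρc, hcost]; exact hγfin)
      (fun π' h' => by rw [hρ.1, hρ.2] at h'; rw [hρc]; exact hopt π' h')
      (by rw [hρ.1]; exact hA2)
    have hac1 : π ≪ ρ := by
      refine Measure.AbsolutelyContinuous.mk fun s _ h0 => ?_
      have h0' : π s = 0 ∧ πs s = 0 := by simpa [ρ] using h0
      exact h0'.1
    have hac2 : πs ≪ ρ := by
      refine Measure.AbsolutelyContinuous.mk fun s _ h0 => ?_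
      have h0' : π s = 0 ∧ πs s = 0 := by simpa [ρ] using h0
      exact h0'.2
    have r1 := eq_graph π (fun z => T' (θbar z)) (hT'.comp hθm) (hac1.ae_le hρT)
    have r2 := eq_graph πs (fun z => T' (θbar z)) (hT'.comp hθm) (hac2.ae_le hρT)
    rw [h.1] at r1
    rw [hs.1] at r2
    exact r1.trans r2.symm
  have hdec : ∀ δ : Vec d → Vec m, Measurable δ → μ.map δ = G →
      ∫⁻ p, ENNReal.ofReal (‖δ p.1 - p.2‖ ^ 2) ∂P =
      ∫⁻ p, ENNReal.ofReal (‖θbar p.1 - p.2‖ ^ 2) ∂(μ.map fun z => (z, δ z)) +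
      ∫⁻ p, ENNReal.ofReal (‖θbar p.1 - p.2‖ ^ 2) ∂P := by
    intro δ hδ hδG
    have hδ2 : MemLp (fun p : Vec d × Vec m => δ p.1) 2 P := by
      have h1 : MemLp (fun x : Vec m => x) 2 (P.map fun p => δ p.1) := by
        have : P.map (fun p => δ p.1) = G := by
          rw [← hδG, hμ, Measure.map_map hδ measurable_fst]
          rfl
        rw [this]; exact hGL
      exact h1.comp_of_map (by fun_prop)
    rw [bayes_decomp P θbar hθbar hP2 δ hδ hδ2]
    congr 1
    rw [lintegral_map hcm (by fun_prop), hμ, lintegral_map (by fun_prop) measurable_fst]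
  refine ⟨fun z => T (θbar z), hδm, hδG, hopt, huniq, ?_, ?_, ?_⟩
  · intro δ' hδ' h
    exact ae_eq_of_graph_eq μ _ _ hδ' hδm h
  · intro δ hδ hδG'
    rw [hdec δ hδ hδG', hdec _ hδm hδG]
    exact add_le_add_left (hopt _ (hgr δ hδ hδG')) _
  · intro δ hδ hδG' h
    rw [hdec δ hδ hδG', hdec _ hδm hδG] at h
    have h' := (ENNReal.add_left_inj hPfin.ne).mp h
    exact ae_eq_of_graph_eq μ _ _ hδ hδm (huniq _ (hgr δ hδ hδG') h')
end
end

section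
/- Under Assumptions 1 and 2, the OT-based denoiser δ* satisfies δ*(z) = ∇φ*(θ̄(z)) for μ-a.e. z, where φ* : ℝ^m → ℝ ∪ {+∞} is a convex function; moreover T* := ∇φ* pushes θ̄♯μ forward to G* and is the θ̄♯μ-a.e. unique minimizer of ∫|y − T(y)|² d(θ̄♯μ)(y) over all measurable maps T : ℝ^m → ℝ^m with T♯(θ̄♯μ) = G*. -/
open MeasureTheory ProbabilityTheory Filter RealInnerProductSpace
open scoped ENNReal

noncomputable section

lemma cyc_mono_aux {m n : ℕ} (q : Fin (n+1) → Vec m × Vec m) {ε : ℝ} (hε : 0 < ε) :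
    ∃ r > 0, ∀ i j, ∀ x y : Vec m, dist x (q i).1 < r → dist y (q j).2 < r →
      |‖x - y‖ ^ 2 - ‖(q i).1 - (q j).2‖ ^ 2| < ε := by
  have h : ∀ᶠ r in nhdsWithin (0:ℝ) (Set.Ioi 0), ∀ i j, ∀ x y : Vec m,
      dist x (q i).1 < r → dist y (q j).2 < r →
      |‖x - y‖ ^ 2 - ‖(q i).1 - (q j).2‖ ^ 2| < ε := by
    rw [eventually_all]; intro i
    rw [eventually_all]; intro j
    have hc : Continuous (fun p : Vec m × Vec m => ‖p.1 - p.2‖ ^ 2) := by fun_prop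
    obtain ⟨δ, hδ, H⟩ := Metric.continuous_iff.1 hc ((q i).1, (q j).2) ε hε
    filter_upwards [Ioo_mem_nhdsGT hδ] with r hr x y hx hy
    have := H (x, y) (by rw [Prod.dist_eq]; exact max_lt (hx.trans hr.2) (hy.trans hr.2))
    simpa [Real.dist_eq] using this
  obtain ⟨r, h1, h2⟩ := (h.and self_mem_nhdsWithin).exists
  exact ⟨r, h2, h1⟩

lemma cyc_mono {X : Type*} [MeasurableSpace X] {m n : ℕ} (π : Measure (X × Vec m))
    [IsProbabilityMeasure π] (f : X → Vec m) (hf : Measurable f)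
    (hfin : ∫⁻ p, ENNReal.ofReal (‖f p.1 - p.2‖ ^ 2) ∂π < ⊤)
    (hmin : ∀ π' : Measure (X × Vec m), IsCoupling π' (π.map Prod.fst) (π.map Prod.snd) →
      ∫⁻ p, ENNReal.ofReal (‖f p.1 - p.2‖ ^ 2) ∂π ≤
        ∫⁻ p, ENNReal.ofReal (‖f p.1 - p.2‖ ^ 2) ∂π')
    (q : Fin (n+1) → Vec m × Vec m)
    (hq : ∀ i, q i ∈ (π.map (fun p => (f p.1, p.2))).support) (σ : Equiv.Perm (Fin (n+1))) :
    ∑ i, ‖(q i).1 - (q i).2‖ ^ 2 ≤ ∑ i, ‖(q i).1 - (q (σ i)).2‖ ^ 2 := by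
  have hF : Measurable (fun p : X × Vec m => (f p.1, p.2)) := by fun_prop
  set c : X × Vec m → ℝ≥0∞ := fun p => ENNReal.ofReal (‖f p.1 - p.2‖ ^ 2) with hc
  have hcm : Measurable c := by fun_prop
  have key : ∀ ε : ℝ, 0 < ε → ∑ i, ‖(q i).1 - (q i).2‖ ^ 2 ≤
      ∑ i, ‖(q i).1 - (q (σ i)).2‖ ^ 2 + (2 * (n+1) : ℝ) * ε := by
    intro ε hε
    obtain ⟨r, hr, H⟩ := cyc_mono_aux q hε
    let A : Fin (n+1) → Set (X × Vec m) := fun i =>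
      {p | dist (f p.1) (q i).1 < r ∧ dist p.2 (q i).2 < r}
    have hA : ∀ i, MeasurableSet (A i) := by
      intro i
      have m1 : Measurable fun p : X × Vec m => dist (f p.1) (q i).1 := by fun_prop
      have m2 : Measurable fun p : X × Vec m => dist p.2 (q i).2 := by fun_prop
      exact (measurableSet_lt m1 measurable_const).inter
        (measurableSet_lt m2 measurable_const)
    have hA0 : ∀ i, π (A i) ≠ 0 := by
      intro i
      have h1 := (Measure.mem_support_iff_forall _).1 (hq i) (Metric.ball (q i) r)
        (Metric.ball_mem_nhds _ hr)
      rw [Measure.map_apply hF Metric.isOpen_ball.measurableSet] at h1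
      convert h1.ne' using 2
      ext p
      simp [A, Prod.dist_eq]
    let K : Fin (n+1) → Measure (X × Vec m) := fun i => (π (A i))⁻¹ • π.restrict (A i)
    have hK : ∀ i, IsProbabilityMeasure (K i) := fun i => cond_isProbabilityMeasure (hA0 i)
    have hKA : ∀ i, ∀ᵐ p ∂(K i), p ∈ A i := fun i =>
      Measure.ae_smul_measure (ae_restrict_mem (hA i)) _
    set s : ℝ≥0∞ := ∑ i, (π (A i))⁻¹ with hs
    have hs0 : s ≠ 0 := by
      intro h
      have := (Finset.sum_eq_zero_iff.1 h) 0 (Finset.mem_univ _)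
      simp at this
    have hst : s ≠ ⊤ := by
      rw [hs, ENNReal.sum_ne_top]
      intro i _
      exact ENNReal.inv_ne_top.2 (hA0 i)
    have ht0 : s⁻¹ ≠ 0 := ENNReal.inv_ne_zero.2 hst
    have htt : s⁻¹ ≠ ⊤ := ENNReal.inv_ne_top.2 hs0
    set κ : Measure (X × Vec m) := s⁻¹ • ∑ i, K i with hκ
    have hle : κ ≤ π := by
      rw [Measure.le_iff]
      intro B hB
      simp only [hκ, Measure.smul_apply, Measure.finsetSum_apply, K, smul_eq_mul]
      calc s⁻¹ * ∑ i, (π (A i))⁻¹ * π.restrict (A i) B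
          ≤ s⁻¹ * ∑ i, (π (A i))⁻¹ * π B := by
            gcongr; exact Measure.restrict_le_self
        _ = π B := by
            rw [← Finset.sum_mul, ← mul_assoc, ENNReal.inv_mul_cancel hs0 hst, one_mul]
    have hκf : IsFiniteMeasure κ := isFiniteMeasure_of_le π hle
    set ρ := π - κ with hρ
    have hdec : ρ + κ = π := Measure.sub_add_cancel_of_le hle
    let L : Fin (n+1) → Measure (X × Vec m) := fun i =>
      ((K i).map Prod.fst).prod ((K (σ i)).map Prod.snd)
    have hp1 : ∀ i, IsProbabilityMeasure ((K i).map Prod.fst) := fun i =>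
      Measure.isProbabilityMeasure_map measurable_fst.aemeasurable
    have hp2 : ∀ i, IsProbabilityMeasure ((K i).map Prod.snd) := fun i =>
      Measure.isProbabilityMeasure_map measurable_snd.aemeasurable
    have hL : ∀ i, IsProbabilityMeasure (L i) := fun i => by
      dsimp only [L]; infer_instance
    have hcoup : IsCoupling (ρ + s⁻¹ • ∑ i, L i) (π.map Prod.fst) (π.map Prod.snd) := by
      constructor
      · conv_rhs => rw [← hdec]
        ext B hB
        simp only [hκ, Measure.map_apply measurable_fst hB, Measure.add_apply,
          Measure.smul_apply, Measure.finsetSum_apply]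
        congr 3 with i
        have : L i (Prod.fst ⁻¹' B) = (L i).map Prod.fst B :=
          (Measure.map_apply measurable_fst hB).symm
        rw [this, Measure.map_fst_prod, Measure.smul_apply, Measure.map_apply measurable_fst hB]
        simp
      · conv_rhs => rw [← hdec]
        ext B hB
        simp only [hκ, Measure.map_apply measurable_snd hB, Measure.add_apply,
          Measure.smul_apply, Measure.finsetSum_apply]
        congr 2
        rw [← Equiv.sum_comp σ (fun i => K i (Prod.snd ⁻¹' B))]
        congr 1 with i
        have : L i (Prod.snd ⁻¹' B) = (L i).map Prod.snd B :=
          (Measure.map_apply measurable_snd hB).symm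
        rw [this, Measure.map_snd_prod, Measure.smul_apply, Measure.map_apply measurable_snd hB]
        simp
    have h1 := hmin _ hcoup
    have h2 : ∫⁻ p, c p ∂ρ ≠ ⊤ := by
      refine ne_top_of_le_ne_top hfin.ne ?_
      exact lintegral_mono' (Measure.sub_le) le_rfl
    have h3 : ∑ i, ∫⁻ p, c p ∂(K i) ≤ ∑ i, ∫⁻ p, c p ∂(L i) := by
      conv_lhs at h1 => rw [← hdec]
      rw [lintegral_add_measure, lintegral_add_measure, hκ, lintegral_smul_measure,
        lintegral_smul_measure, lintegral_finsetSum_measure, lintegral_finsetSum_measure,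
        ENNReal.add_le_add_iff_left h2] at h1
      exact (ENNReal.mul_le_mul_iff_right ht0 htt).1 h1
    have h4 : ∀ i, ENNReal.ofReal (‖(q i).1 - (q i).2‖ ^ 2) ≤
        ∫⁻ p, c p ∂(K i) + ENNReal.ofReal ε := by
      intro i
      have : ENNReal.ofReal (‖(q i).1 - (q i).2‖ ^ 2) =
        ∫⁻ p, ENNReal.ofReal (‖(q i).1 - (q i).2‖ ^ 2) ∂(K i) := by simp
      rw [this]
      have h5 : ∫⁻ p, c p ∂(K i) + ENNReal.ofReal ε =
        ∫⁻ p, (c p + ENNReal.ofReal ε) ∂(K i) := by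
          rw [lintegral_add_right _ measurable_const]; simp
      rw [h5]
      refine lintegral_mono_ae ?_
      filter_upwards [hKA i] with p hp
      rw [hc, ← ENNReal.ofReal_add (by positivity) hε.le]
      apply ENNReal.ofReal_le_ofReal
      have := (abs_lt.1 (H i i _ _ hp.1 hp.2)).1
      linarith
    have h6 : ∀ i, ∫⁻ p, c p ∂(L i) ≤
        ENNReal.ofReal (‖(q i).1 - (q (σ i)).2‖ ^ 2 + ε) := by
      intro i
      have : ENNReal.ofReal (‖(q i).1 - (q (σ i)).2‖ ^ 2 + ε) =
        ∫⁻ p, ENNReal.ofReal (‖(q i).1 - (q (σ i)).2‖ ^ 2 + ε) ∂(L i) := by simp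
      rw [this]
      refine lintegral_mono_ae ?_
      have e1 : ∀ᵐ p ∂(L i), dist (f p.1) (q i).1 < r := by
        have : ∀ᵐ x ∂((K i).map Prod.fst), dist (f x) (q i).1 < r := by
          rw [ae_map_iff measurable_fst.aemeasurable
            (measurableSet_lt (by fun_prop) measurable_const)]
          filter_upwards [hKA i] with p hp using hp.1
        exact Measure.quasiMeasurePreserving_fst.ae this
      have e2 : ∀ᵐ p ∂(L i), dist p.2 (q (σ i)).2 < r := by
        have : ∀ᵐ x ∂((K (σ i)).map Prod.snd), dist x (q (σ i)).2 < r := by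
          rw [ae_map_iff measurable_snd.aemeasurable
            (measurableSet_lt (by fun_prop) measurable_const)]
          filter_upwards [hKA (σ i)] with p hp using hp.2
        exact Measure.quasiMeasurePreserving_snd.ae this
      filter_upwards [e1, e2] with p hp1 hp2
      apply ENNReal.ofReal_le_ofReal
      have := (abs_lt.1 (H i (σ i) _ _ hp1 hp2)).2
      linarith
    have h7 : ∑ i, ENNReal.ofReal (‖(q i).1 - (q i).2‖ ^ 2) ≤
        ∑ i : Fin (n+1), (ENNReal.ofReal (‖(q i).1 - (q (σ i)).2‖ ^ 2 + ε) + ENNReal.ofReal ε) := by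
      calc _ ≤ ∑ i, (∫⁻ p, c p ∂(K i) + ENNReal.ofReal ε) := Finset.sum_le_sum fun i _ => h4 i
        _ = ∑ i, ∫⁻ p, c p ∂(K i) + ∑ i : Fin (n+1), ENNReal.ofReal ε := Finset.sum_add_distrib
        _ ≤ ∑ i, ∫⁻ p, c p ∂(L i) + ∑ i : Fin (n+1), ENNReal.ofReal ε := by gcongr
        _ = ∑ i, (∫⁻ p, c p ∂(L i) + ENNReal.ofReal ε) := Finset.sum_add_distrib.symm
        _ ≤ _ := Finset.sum_le_sum fun i _ => by gcongr; exact h6 i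
    have h8 : ∀ i, ENNReal.ofReal (‖(q i).1 - (q (σ i)).2‖ ^ 2 + ε) + ENNReal.ofReal ε =
        ENNReal.ofReal (‖(q i).1 - (q (σ i)).2‖ ^ 2 + ε + ε) := fun i =>
      (ENNReal.ofReal_add (by positivity) hε.le).symm
    simp only [h8] at h7
    rw [← ENNReal.ofReal_sum_of_nonneg (fun i _ => by positivity),
      ← ENNReal.ofReal_sum_of_nonneg (fun i _ => by positivity),
      ENNReal.ofReal_le_ofReal_iff (Finset.sum_nonneg fun i _ => by positivity)] at h7
    refine h7.trans (le_of_eq ?_)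
    rw [Finset.sum_add_distrib, Finset.sum_add_distrib]
    simp
    ring
  refine le_of_forall_pos_le_add fun ε hε => ?_
  have := key (ε / (2 * (n+1))) (by positivity)
  rwa [mul_div_cancel₀ _ (by positivity)] at this

lemma cyc_mono_nat {X : Type*} [MeasurableSpace X] {m : ℕ} (π : Measure (X × Vec m))
    [IsProbabilityMeasure π] (f : X → Vec m) (hf : Measurable f)
    (hfin : ∫⁻ p, ENNReal.ofReal (‖f p.1 - p.2‖ ^ 2) ∂π < ⊤)
    (hmin : ∀ π' : Measure (X × Vec m), IsCoupling π' (π.map Prod.fst) (π.map Prod.snd) →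
      ∫⁻ p, ENNReal.ofReal (‖f p.1 - p.2‖ ^ 2) ∂π ≤
        ∫⁻ p, ENNReal.ofReal (‖f p.1 - p.2‖ ^ 2) ∂π')
    (n : ℕ) (q : ℕ → Vec m × Vec m)
    (hq : ∀ i, q i ∈ (π.map (fun p => (f p.1, p.2))).support) :
    ∑ i ∈ Finset.range n, ⟪(q (i+1)).1 - (q i).1, (q i).2⟫ +
      ⟪(q 0).1 - (q n).1, (q n).2⟫ ≤ 0 := by
  have h := cyc_mono (n := n) π f hf hfin hmin (fun i => q i) (fun i => hq i)
    (finRotate (n+1)).symm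
  rw [← Equiv.sum_comp (finRotate (n+1))
    (fun i => ‖(q (i : Fin (n+1))).1 - (q ((finRotate (n+1)).symm i : Fin (n+1))).2‖ ^ 2)] at h
  simp only [Equiv.symm_apply_apply] at h
  have h1 : ∀ x y : Vec m, ‖x - y‖ ^ 2 = ‖x‖ ^ 2 - 2 * ⟪x, y⟫ + ‖y‖ ^ 2 := norm_sub_sq_real
  simp only [h1, Finset.sum_add_distrib, Finset.sum_sub_distrib, ← Finset.mul_sum] at h
  rw [Equiv.sum_comp (finRotate (n+1)) (fun i => ‖(q (i : Fin (n+1))).1‖ ^ 2)] at h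
  have h2 : ∑ i : Fin (n+1), ⟪(q (finRotate (n+1) i : Fin (n+1))).1, (q i).2⟫ ≤
    ∑ i : Fin (n+1), ⟪(q i).1, (q i).2⟫ := by linarith
  rw [Fin.sum_univ_castSucc, Fin.sum_univ_castSucc, finRotate_last] at h2
  have h3 : ∀ i : Fin n, ((finRotate (n+1) i.castSucc : Fin (n+1)) : ℕ) = i + 1 := by
    intro i
    have := finRotate_of_lt i.2
    rw [show (i.castSucc : Fin (n+1)) = ⟨i, i.2.trans_le n.le_succ⟩ from rfl, this]
  simp only [h3, Fin.val_castSucc, Fin.val_last, Fin.val_zero] at h2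
  rw [Fin.sum_univ_eq_sum_range (fun i => ⟪(q (i+1)).1, (q i).2⟫) n,
    Fin.sum_univ_eq_sum_range (fun i => ⟪(q i).1, (q i).2⟫) n] at h2
  simp only [inner_sub_left, Finset.sum_sub_distrib]
  linarith

inductive RChain {m : ℕ} (S : Set (Vec m × Vec m)) (p0 : Vec m × Vec m) :
    Vec m × Vec m → ℝ → Prop
  | base : RChain S p0 p0 0
  | step (p q : Vec m × Vec m) (a : ℝ) : RChain S p0 p a → q ∈ S →
      RChain S p0 q (a + ⟪q.1 - p.1, p.2⟫)

lemma RChain.exists_seq {m : ℕ} {S : Set (Vec m × Vec m)} {p0 : Vec m × Vec m} (h0 : p0 ∈ S)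
    {p : Vec m × Vec m} {a : ℝ} (h : RChain S p0 p a) :
    ∃ (n : ℕ) (q : ℕ → Vec m × Vec m), (∀ i, q i ∈ S) ∧ q 0 = p0 ∧ q n = p ∧
      a = ∑ i ∈ Finset.range n, ⟪(q (i+1)).1 - (q i).1, (q i).2⟫ := by
  induction h with
  | base => exact ⟨0, fun _ => p0, fun _ => h0, rfl, rfl, by simp⟩
  | step p r a _ hr ih =>
    obtain ⟨n, q, hq, hq0, hqn, ha⟩ := ih
    refine ⟨n+1, fun i => if i ≤ n then q i else r, fun i => ?_, by simpa using hq0, by simp, ?_⟩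
    · dsimp only; split_ifs
      · exact hq i
      · exact hr
    · rw [Finset.sum_range_succ, ha]
      congr 1
      · refine Finset.sum_congr rfl fun i hi => ?_
        have := Finset.mem_range.1 hi
        dsimp only
        rw [if_pos (by omega), if_pos (by omega)]
      · simp [hqn]

def rockPot {m : ℕ} (S : Set (Vec m × Vec m)) (p0 : Vec m × Vec m) (x : Vec m) : EReal :=
  ⨆ (p : Vec m × Vec m) (a : ℝ) (_ : RChain S p0 p a), ((a + ⟪x - p.1, p.2⟫ : ℝ) : EReal)

section
variable {m : ℕ} {S : Set (Vec m × Vec m)} {p0 : Vec m × Vec m}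

lemma le_rockPot {p : Vec m × Vec m} {a : ℝ} (h : RChain S p0 p a) (x : Vec m) :
    ((a + ⟪x - p.1, p.2⟫ : ℝ) : EReal) ≤ rockPot S p0 x :=
  le_iSup_of_le p <| le_iSup_of_le a <| le_iSup_of_le h le_rfl

lemma rockPot_ne_bot (x : Vec m) : rockPot S p0 x ≠ ⊥ := by
  intro h
  have := le_rockPot (RChain.base (S := S) (p0 := p0)) x
  rw [h, le_bot_iff] at this
  exact EReal.coe_ne_bot _ this

lemma rockPot_convex (x y : Vec m) (t : ℝ) (h0 : 0 ≤ t) (h1 : t ≤ 1) :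
    rockPot S p0 (t • x + (1 - t) • y) ≤
      (t : EReal) * rockPot S p0 x + ((1 - t : ℝ) : EReal) * rockPot S p0 y := by
  refine iSup_le fun p => iSup_le fun a => iSup_le fun h => ?_
  have e : a + ⟪t • x + (1 - t) • y - p.1, p.2⟫ =
      t * (a + ⟪x - p.1, p.2⟫) + (1 - t) * (a + ⟪y - p.1, p.2⟫) := by
    simp only [inner_sub_left, inner_add_left, real_inner_smul_left]
    ring
  rw [e, EReal.coe_add, EReal.coe_mul, EReal.coe_mul]
  refine add_le_add ?_ ?_
  · exact mul_le_mul_of_nonneg_left (le_rockPot h x) (by exact_mod_cast h0)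
  · exact mul_le_mul_of_nonneg_left (le_rockPot h y) (by exact_mod_cast sub_nonneg.2 h1)

lemma rockPot_base (h0 : p0 ∈ S)
    (hS : ∀ (n : ℕ) (q : ℕ → Vec m × Vec m), (∀ i, q i ∈ S) →
      ∑ i ∈ Finset.range n, ⟪(q (i+1)).1 - (q i).1, (q i).2⟫ +
      ⟪(q 0).1 - (q n).1, (q n).2⟫ ≤ 0) : rockPot S p0 p0.1 ≤ 0 := by
  refine iSup_le fun p => iSup_le fun a => iSup_le fun h => ?_
  obtain ⟨n, q, hq, hq0, hqn, ha⟩ := h.exists_seq h0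
  have := hS n q hq
  rw [hq0, hqn, ← ha] at this
  exact_mod_cast this

lemma rockPot_subgrad {q : Vec m × Vec m} (hq : q ∈ S) (z : Vec m) :
    rockPot S p0 q.1 + ((⟪z - q.1, q.2⟫ : ℝ) : EReal) ≤ rockPot S p0 z := by
  rw [← EReal.le_sub_iff_add_le (by simp) (by simp)]
  refine iSup_le fun p => iSup_le fun a => iSup_le fun h => ?_
  rw [EReal.le_sub_iff_add_le (by simp) (by simp)]
  have := le_rockPot (RChain.step p q a h hq) z
  rwa [EReal.coe_add] at this

lemma rockPot_ne_top (h0 : p0 ∈ S)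
    (hS : ∀ (n : ℕ) (q : ℕ → Vec m × Vec m), (∀ i, q i ∈ S) →
      ∑ i ∈ Finset.range n, ⟪(q (i+1)).1 - (q i).1, (q i).2⟫ +
      ⟪(q 0).1 - (q n).1, (q n).2⟫ ≤ 0)
    {q : Vec m × Vec m} (hq : q ∈ S) : rockPot S p0 q.1 ≠ ⊤ := by
  intro h
  have h1 := (rockPot_subgrad hq p0.1).trans (rockPot_base h0 hS)
  rw [h, EReal.top_add_coe, top_le_iff] at h1
  exact EReal.zero_ne_top h1
end

lemma convex_ae_diff {m : ℕ} (φ : Vec m → EReal) (hbot : ∀ y, φ y ≠ ⊥)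
    (hconv : ∀ x y : Vec m, ∀ t : ℝ, 0 ≤ t → t ≤ 1 →
        φ (t • x + (1 - t) • y) ≤ (t : EReal) * φ x + ((1 - t : ℝ) : EReal) * φ y) :
    ∀ᵐ y, φ y ≠ ⊤ → ((∀ᶠ y' in nhds y, φ y' ≠ ⊤) ∧
      DifferentiableAt ℝ (fun x => (φ x).toReal) y) := by
  set D : Set (Vec m) := {y | φ y ≠ ⊤} with hD
  set g : Vec m → ℝ := fun x => (φ x).toReal with hg
  have hgφ : ∀ x ∈ D, φ x = (g x : EReal) := fun x hx => (EReal.coe_toReal hx (hbot x)).symm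
  have hle : ∀ x ∈ D, ∀ y ∈ D, ∀ t : ℝ, 0 ≤ t → t ≤ 1 →
      φ (t • x + (1 - t) • y) ≤ ((t * g x + (1 - t) * g y : ℝ) : EReal) := by
    intro x hx y hy t h0 h1
    have := hconv x y t h0 h1
    rwa [hgφ x hx, hgφ y hy, ← EReal.coe_mul, ← EReal.coe_mul, ← EReal.coe_add] at this
  have hDc : Convex ℝ D := by
    intro x hx y hy a b ha hb hab
    obtain rfl : b = 1 - a := by linarith
    exact ne_top_of_le_ne_top (EReal.coe_ne_top _) (hle x hx y hy a ha (by linarith))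
  have hgc : ConvexOn ℝ D g := by
    refine ⟨hDc, ?_⟩
    intro x hx y hy a b ha hb hab
    have hm := hDc hx hy ha hb hab
    obtain rfl : b = 1 - a := by linarith
    have := hle x hx y hy a ha (by linarith)
    rw [hgφ _ hm] at this
    simpa using EReal.coe_le_coe_iff.1 this
  have hlip := hgc.locallyLipschitzOn_interior
  have hnull : volume {x | x ∈ interior D ∧ ¬ DifferentiableAt ℝ g x} = 0 := by
    apply measure_null_of_locally_null
    rintro x ⟨hx, -⟩
    obtain ⟨K, t, ht, hK⟩ := hlip hx
    rw [isOpen_interior.nhdsWithin_eq hx] at ht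
    obtain ⟨u, hut, huo, hxu⟩ := mem_nhds_iff.1 ht
    have h1 := (hK.mono hut).ae_differentiableWithinAt_of_mem (μ := (volume : Measure (Vec m)))
    refine ⟨{x | x ∈ interior D ∧ ¬ DifferentiableAt ℝ g x} ∩ u,
      inter_mem_nhdsWithin _ (huo.mem_nhds hxu), ?_⟩
    refine measure_mono_null ?_ h1
    rintro y ⟨⟨_, hy⟩, hyu⟩ hcon
    exact hy ((hcon hyu).differentiableAt (huo.mem_nhds hyu))
  have h1 : ∀ᵐ y : Vec m, ¬ (y ∈ interior D ∧ ¬ DifferentiableAt ℝ g y) := by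
    rw [ae_iff]; simpa using hnull
  have h2 : ∀ᵐ y : Vec m, y ∉ frontier D :=
    measure_eq_zero_iff_ae_notMem.1 (hDc.addHaar_frontier volume)
  filter_upwards [h1, h2] with y hy1 hy2 hyD
  have hyi : y ∈ interior D := by
    by_contra hcon
    exact hy2 ⟨subset_closure hyD, hcon⟩
  refine ⟨mem_interior_iff_mem_nhds.1 hyi, ?_⟩
  by_contra hcon
  exact hy1 ⟨hyi, hcon⟩

lemma grad_of_subgrad {m : ℕ} (φ : Vec m → EReal) (hbot : ∀ y, φ y ≠ ⊥) {y v : Vec m}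
    (hfin : ∀ᶠ y' in nhds y, φ y' ≠ ⊤) (hd : DifferentiableAt ℝ (fun x => (φ x).toReal) y)
    (hsub : ∀ z, φ y + ((⟪z - y, v⟫ : ℝ) : EReal) ≤ φ z) :
    HasGradientAt (fun x => (φ x).toReal) v y := by
  set g : Vec m → ℝ := fun x => (φ x).toReal with hg
  have hloc : IsLocalMin (fun z => g z - ⟪v, z⟫) y := by
    filter_upwards [hfin] with z hz
    have h := hsub z
    rw [← EReal.coe_toReal hz (hbot z), ← EReal.coe_toReal hfin.self_of_nhds (hbot y),
      ← EReal.coe_add, EReal.coe_le_coe_iff] at h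
    change g y + _ ≤ g z at h
    rw [inner_sub_left, real_inner_comm, real_inner_comm v y] at h
    linarith
  have h1 : HasFDerivAt (fun z : Vec m => ⟪v, z⟫) (InnerProductSpace.toDual ℝ (Vec m) v) y :=
    (InnerProductSpace.toDual ℝ (Vec m) v).hasFDerivAt
  have h2 := hd.hasFDerivAt.sub h1
  have h3 := hloc.hasFDerivAt_eq_zero h2
  rw [hasGradientAt_iff_hasFDerivAt, ← sub_eq_zero.1 h3]
  exact hd.hasFDerivAt

lemma key_pot {X : Type*} [MeasurableSpace X] {m : ℕ} (π : Measure (X × Vec m))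
    [IsProbabilityMeasure π] (f : X → Vec m) (hf : Measurable f)
    (hac : (π.map (fun p => f p.1)) ≪ (volume : Measure (Vec m)))
    (hfin : ∫⁻ p, ENNReal.ofReal (‖f p.1 - p.2‖ ^ 2) ∂π < ⊤)
    (hmin : ∀ π' : Measure (X × Vec m), IsCoupling π' (π.map Prod.fst) (π.map Prod.snd) →
      ∫⁻ p, ENNReal.ofReal (‖f p.1 - p.2‖ ^ 2) ∂π ≤
        ∫⁻ p, ENNReal.ofReal (‖f p.1 - p.2‖ ^ 2) ∂π') :
    ∃ φ : Vec m → EReal, (∀ y, φ y ≠ ⊥) ∧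
      (∀ x y : Vec m, ∀ t : ℝ, 0 ≤ t → t ≤ 1 →
        φ (t • x + (1 - t) • y) ≤ (t : EReal) * φ x + ((1 - t : ℝ) : EReal) * φ y) ∧
      ∀ᵐ p ∂π, (∀ᶠ y' in nhds (f p.1), φ y' ≠ ⊤) ∧
        HasGradientAt (fun x => (φ x).toReal) p.2 (f p.1) := by
  have hF : Measurable (fun p : X × Vec m => (f p.1, p.2)) := by fun_prop
  have hS := cyc_mono_nat π f hf hfin hmin
  have : IsProbabilityMeasure (π.map (fun p => (f p.1, p.2))) :=
    Measure.isProbabilityMeasure_map hF.aemeasurable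
  generalize hSdef : (π.map (fun p => (f p.1, p.2))).support = S at hS
  obtain ⟨p0, hp0⟩ : S.Nonempty := hSdef ▸ Measure.nonempty_support (IsProbabilityMeasure.ne_zero _)
  have hae : ∀ᵐ p ∂π, (f p.1, p.2) ∈ S :=
    hSdef ▸ ae_of_ae_map hF.aemeasurable Measure.support_mem_ae
  obtain ⟨φ, hb, hcv, hsg, hnt⟩ : ∃ φ : Vec m → EReal, (∀ y, φ y ≠ ⊥) ∧
      (∀ x y : Vec m, ∀ t : ℝ, 0 ≤ t → t ≤ 1 →
        φ (t • x + (1 - t) • y) ≤ (t : EReal) * φ x + ((1 - t : ℝ) : EReal) * φ y) ∧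
      (∀ q ∈ S, ∀ z, φ q.1 + ((⟪z - q.1, q.2⟫ : ℝ) : EReal) ≤ φ z) ∧
      (∀ q ∈ S, φ q.1 ≠ ⊤) :=
    ⟨rockPot S p0, rockPot_ne_bot, rockPot_convex, fun q hq z => rockPot_subgrad hq z,
      fun q hq => rockPot_ne_top hp0 hS hq⟩
  have hd := convex_ae_diff φ hb hcv
  have hfm : Measurable (fun p : X × Vec m => f p.1) := by fun_prop
  have hd' : ∀ᵐ p ∂π, φ (f p.1) ≠ ⊤ →
      ((∀ᶠ y' in nhds (f p.1), φ y' ≠ ⊤) ∧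
      DifferentiableAt ℝ (fun x => (φ x).toReal) (f p.1)) :=
    ae_of_ae_map hfm.aemeasurable (hac.ae_le hd)
  refine ⟨φ, hb, hcv, ?_⟩
  filter_upwards [hae, hd'] with p hp h
  have hnt' := hnt _ hp
  have hsg' := hsg _ hp
  dsimp only at hnt' hsg'
  obtain ⟨h1, h2⟩ := h hnt'
  exact ⟨h1, grad_of_subgrad φ hb h1 h2 hsg'⟩

lemma measurable_grad {m : ℕ} (g : Vec m → ℝ) : Measurable (gradient g) := by
  have : gradient g = (InnerProductSpace.toDual ℝ (Vec m)).symm ∘ fderiv ℝ g := rfl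
  rw [this]
  exact (InnerProductSpace.toDual ℝ (Vec m)).symm.continuous.measurable.comp (measurable_fderiv ℝ g)

lemma lint_sq_memLp {X : Type*} [MeasurableSpace X] {m : ℕ} {ν : Measure X} {f : X → Vec m}
    (hf : AEStronglyMeasurable f ν) :
    MemLp f 2 ν ↔ ∫⁻ x, ENNReal.ofReal (‖f x‖ ^ 2) ∂ν < ⊤ := by
  rw [memLp_two_iff_integrable_sq_norm hf, ← hasFiniteIntegral_iff_ofReal
    (Eventually.of_forall fun x => by positivity)]
  exact ⟨fun h => h.2, fun h => ⟨hf.norm.pow 2, h⟩⟩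

/-- Under Assumptions 1 and 2, the OT-based denoiser `δ*` satisfies
`δ*(z) = ∇φ*(θ̄(z))` for `μ`-a.e. `z`, where `φ* : ℝ^m → ℝ ∪ {+∞}` is convex; moreover
`T* := ∇φ*` pushes `θ̄♯μ` to `G*` and is the `θ̄♯μ`-a.e. unique minimizer of the Monge
problem `∫‖y − T(y)‖² d(θ̄♯μ)` over measurable `T` with `T♯(θ̄♯μ) = G*`. -/
theorem stmt1 {d m : ℕ}
    (P : Measure (Vec d × Vec m)) [IsProbabilityMeasure P]
    (μ : Measure (Vec d)) (G : Measure (Vec m))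
    (hμ : μ = P.map Prod.fst) (hG : G = P.map Prod.snd)
    (θbar : Vec d → Vec m) (hθbar : IsPosteriorMean P θbar)
    -- Assumption 1
    (hA1 : ∫⁻ θ, ENNReal.ofReal (‖θ‖ ^ 2) ∂G < ⊤)
    -- Assumption 2
    (hA2 : (μ.map θbar) ≪ (volume : Measure (Vec m)))
    -- `δ*` is the OT-based denoiser: `(Id × δ*)♯μ` minimizes the Kantorovich problem
    (δstar : Vec d → Vec m) (hδmeas : Measurable δstar) (hδpush : μ.map δstar = G)
    (hδmin : ∀ π : Measure (Vec d × Vec m), IsCoupling π μ G →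
      ∫⁻ p, ENNReal.ofReal (‖θbar p.1 - p.2‖ ^ 2) ∂(μ.map fun z => (z, δstar z)) ≤
        ∫⁻ p, ENNReal.ofReal (‖θbar p.1 - p.2‖ ^ 2) ∂π) :
    ∃ (φ : Vec m → EReal) (Tstar : Vec m → Vec m),
      Measurable Tstar ∧
      -- `φ*` takes values in `ℝ ∪ {+∞}` and is convex
      (∀ y, φ y ≠ ⊥) ∧
      (∀ x y : Vec m, ∀ t : ℝ, 0 ≤ t → t ≤ 1 →
        φ (t • x + (1 - t) • y) ≤ (t : EReal) * φ x + ((1 - t : ℝ) : EReal) * φ y) ∧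
      -- `T* = ∇φ*` at `θ̄♯μ`-a.e. point (where `φ*` is finite near the point)
      (∀ᵐ y ∂(μ.map θbar), (∀ᶠ y' in nhds y, φ y' ≠ ⊤) ∧
        HasGradientAt (fun x => (φ x).toReal) (Tstar y) y) ∧
      -- `δ* = T* ∘ θ̄ = (∇φ*) ∘ θ̄` `μ`-a.e.
      (∀ᵐ z ∂μ, δstar z = Tstar (θbar z)) ∧
      -- `T*` pushes `θ̄♯μ` to `G*`
      (μ.map θbar).map Tstar = G ∧
      -- `T*` minimizes the Monge problem …
      (∀ T : Vec m → Vec m, Measurable T → (μ.map θbar).map T = G →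
        ∫⁻ y, ENNReal.ofReal (‖y - Tstar y‖ ^ 2) ∂(μ.map θbar) ≤
          ∫⁻ y, ENNReal.ofReal (‖y - T y‖ ^ 2) ∂(μ.map θbar)) ∧
      -- … and is its `θ̄♯μ`-a.e. unique minimizer
      (∀ T : Vec m → Vec m, Measurable T → (μ.map θbar).map T = G →
        (∫⁻ y, ENNReal.ofReal (‖y - T y‖ ^ 2) ∂(μ.map θbar) =
          ∫⁻ y, ENNReal.ofReal (‖y - Tstar y‖ ^ 2) ∂(μ.map θbar)) →
        T =ᵐ[μ.map θbar] Tstar) := by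
  obtain ⟨hθm, hθ⟩ := hθbar
  have hμp : IsProbabilityMeasure μ := by
    rw [hμ]; exact Measure.isProbabilityMeasure_map measurable_fst.aemeasurable
  have hgm : Measurable (fun z : Vec d => (z, δstar z)) := by fun_prop
  have hcm : Measurable (fun p : Vec d × Vec m => ENNReal.ofReal (‖θbar p.1 - p.2‖ ^ 2)) := by
    fun_prop
  -- finiteness of the optimal cost
  have hfinP : ∫⁻ p, ENNReal.ofReal (‖θbar p.1 - p.2‖ ^ 2) ∂P < ⊤ := by
    have hsnd : MemLp (fun p : Vec d × Vec m => p.2) 2 P := by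
      rw [lint_sq_memLp measurable_snd.aestronglyMeasurable]
      rw [hG, lintegral_map (by fun_prop) measurable_snd] at hA1
      exact hA1
    have hfst : MemLp (fun p : Vec d × Vec m => θbar p.1) 2 P :=
      (hsnd.condExp (m := MeasurableSpace.comap Prod.fst inferInstance) one_le_two).ae_eq hθ.symm
    have := hfst.sub hsnd
    exact (lint_sq_memLp this.1).1 this
  set π₀ : Measure (Vec d × Vec m) := μ.map fun z => (z, δstar z) with hπ₀
  have hπ₀p : IsProbabilityMeasure π₀ := Measure.isProbabilityMeasure_map hgm.aemeasurable
  have hfin₀ : ∫⁻ p, ENNReal.ofReal (‖θbar p.1 - p.2‖ ^ 2) ∂π₀ < ⊤ :=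
    (hδmin P ⟨hμ.symm, hG.symm⟩).trans_lt hfinP
  have hgraph : ∀ g : Vec d → Vec m, Measurable g →
      (μ.map fun z => (z, g z)).map Prod.fst = μ ∧
      (μ.map fun z => (z, g z)).map Prod.snd = μ.map g := by
    intro g hg
    rw [Measure.map_map measurable_fst (by fun_prop), Measure.map_map measurable_snd (by fun_prop)]
    exact ⟨Measure.map_id, rfl⟩
  have h₀1 : π₀.map Prod.fst = μ := (hgraph δstar hδmeas).1
  have h₀2 : π₀.map Prod.snd = G := (hgraph δstar hδmeas).2.trans hδpush
  have hacπ : ∀ π : Measure (Vec d × Vec m), π.map Prod.fst = μ →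
      (π.map (fun p => θbar p.1)) ≪ (volume : Measure (Vec m)) := by
    intro π h
    have : π.map (fun p => θbar p.1) = μ.map θbar := by
      rw [← h, Measure.map_map hθm measurable_fst]; rfl
    rw [this]; exact hA2
  obtain ⟨φ, hφ1, hφ2, hφ3⟩ := key_pot π₀ θbar hθm (hacπ π₀ h₀1) hfin₀
    (by rw [h₀1, h₀2]; exact hδmin)
  have hae := ae_of_ae_map hgm.aemeasurable hφ3
  set Tstar : Vec m → Vec m := gradient (fun x => (φ x).toReal) with hT
  have hTm : Measurable Tstar := measurable_grad _
  have hδT : ∀ᵐ z ∂μ, δstar z = Tstar (θbar z) := by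
    filter_upwards [hae] with z hz
    exact hz.2.gradient.symm
  have hTpush : (μ.map θbar).map Tstar = G := by
    rw [Measure.map_map hTm hθm, ← hδpush]
    exact Measure.map_congr (hδT.mono fun z hz => hz.symm)
  have hcostg : ∀ g : Vec d → Vec m, Measurable g →
      ∫⁻ p, ENNReal.ofReal (‖θbar p.1 - p.2‖ ^ 2) ∂(μ.map fun z => (z, g z)) =
      ∫⁻ z, ENNReal.ofReal (‖θbar z - g z‖ ^ 2) ∂μ := by
    intro g hg
    rw [lintegral_map hcm (by fun_prop)]
  have hcostT : ∀ T : Vec m → Vec m, Measurable T →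
      ∫⁻ y, ENNReal.ofReal (‖y - T y‖ ^ 2) ∂(μ.map θbar) =
      ∫⁻ p, ENNReal.ofReal (‖θbar p.1 - p.2‖ ^ 2) ∂(μ.map fun z => (z, T (θbar z))) := by
    intro T hTm
    rw [lintegral_map (by fun_prop) hθm, hcostg _ (by fun_prop)]
  have hcost₀ : ∫⁻ y, ENNReal.ofReal (‖y - Tstar y‖ ^ 2) ∂(μ.map θbar) =
      ∫⁻ p, ENNReal.ofReal (‖θbar p.1 - p.2‖ ^ 2) ∂π₀ := by
    rw [hcostT _ hTm, hcostg (fun z => Tstar (θbar z)) (hTm.comp hθm), hcostg _ hδmeas]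
    refine lintegral_congr_ae ?_
    filter_upwards [hδT] with z hz
    rw [hz]
  refine ⟨φ, Tstar, hTm, hφ1, hφ2, ?_, hδT, hTpush, ?_, ?_⟩
  · have hms : MeasurableSet {y : Vec m | (∀ᶠ y' in nhds y, φ y' ≠ ⊤) ∧
        DifferentiableAt ℝ (fun x => (φ x).toReal) y} :=
      isOpen_setOfPred_eventually_nhds.measurableSet.inter (measurableSet_of_differentiableAt ℝ _)
    have hν : ∀ᵐ y ∂(μ.map θbar), (∀ᶠ y' in nhds y, φ y' ≠ ⊤) ∧
        DifferentiableAt ℝ (fun x => (φ x).toReal) y := by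
      rw [ae_map_iff hθm.aemeasurable hms]
      filter_upwards [hae] with z hz
      exact ⟨hz.1, hz.2.differentiableAt⟩
    filter_upwards [hν] with y h1
    exact ⟨h1.1, h1.2.hasGradientAt⟩
  · intro T hTm' hTp
    rw [hcost₀, hcostT T hTm']
    refine hδmin _ ⟨(hgraph _ (hTm'.comp hθm)).1, (hgraph _ (hTm'.comp hθm)).2.trans ?_⟩
    rw [← hTp, Measure.map_map hTm' hθm]
  · intro T hTm' hTp hcost
    have hTθ : Measurable (fun z => T (θbar z)) := hTm'.comp hθm
    rw [hcost₀, hcostT T hTm'] at hcost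
    set π₁ : Measure (Vec d × Vec m) := μ.map fun z => (z, T (θbar z)) with hπ₁
    have hπ₁p : IsProbabilityMeasure π₁ :=
      Measure.isProbabilityMeasure_map (by fun_prop)
    have h₁1 : π₁.map Prod.fst = μ := (hgraph _ hTθ).1
    have h₁2 : π₁.map Prod.snd = G := by
      refine (hgraph _ hTθ).2.trans ?_
      rw [← hTp, Measure.map_map hTm' hθm]; rfl
    set π₂ : Measure (Vec d × Vec m) := (2⁻¹ : ℝ≥0∞) • (π₀ + π₁) with hπ₂
    have h2 : ∀ {Y : Type} [MeasurableSpace Y] (ρ : Measure Y), (2⁻¹ : ℝ≥0∞) • (ρ + ρ) = ρ := by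
      intro Y _ ρ
      rw [← two_smul ℝ≥0∞ ρ, smul_smul, ENNReal.inv_mul_cancel (by simp) (by simp), one_smul]
    have h₂1 : π₂.map Prod.fst = μ := by
      rw [hπ₂, Measure.map_smul, Measure.map_add _ _ measurable_fst, h₀1, h₁1, h2]
    have h₂2 : π₂.map Prod.snd = G := by
      rw [hπ₂, Measure.map_smul, Measure.map_add _ _ measurable_snd, h₀2, h₁2, h2]
    have hπ₂p : IsProbabilityMeasure π₂ := by
      constructor
      rw [← Set.preimage_univ (f := Prod.fst), ← Measure.map_apply measurable_fst MeasurableSet.univ,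
        h₂1, measure_univ]
    have hcost₂ : ∫⁻ p, ENNReal.ofReal (‖θbar p.1 - p.2‖ ^ 2) ∂π₂ =
        ∫⁻ p, ENNReal.ofReal (‖θbar p.1 - p.2‖ ^ 2) ∂π₀ := by
      rw [hπ₂, lintegral_smul_measure, lintegral_add_measure, hcost, ← two_mul, smul_eq_mul,
        ← mul_assoc, ENNReal.inv_mul_cancel (by simp) (by simp), one_mul]
    obtain ⟨ψ, -, -, hψ⟩ := key_pot π₂ θbar hθm (hacπ π₂ h₂1) (hcost₂ ▸ hfin₀)
      (by rw [h₂1, h₂2, hcost₂]; exact hδmin)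
    have hψ' : ∀ᵐ p ∂(π₀ + π₁), HasGradientAt (fun x => (ψ x).toReal) p.2 (θbar p.1) := by
      have : π₀ + π₁ ≪ π₂ := Measure.absolutelyContinuous_smul (by simp)
      filter_upwards [this.ae_le hψ] with p hp using hp.2
    rw [ae_add_measure_iff] at hψ'
    have e0 := ae_of_ae_map hgm.aemeasurable hψ'.1
    have e1 := ae_of_ae_map (by fun_prop) hψ'.2
    have : ∀ᵐ y ∂(μ.map θbar), T y = Tstar y := by
      rw [ae_map_iff hθm.aemeasurable (measurableSet_eq_fun hTm' hTm)]
      filter_upwards [e0, e1, hδT] with z h0 h1 h3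
      rw [← h3]
      exact h1.unique h0
    exact this

end
end

section
/- Under Assumptions 1 and 2, for every τ > 0 the penalized problem of minimizing E_P[|δ(Z) − Θ|²] + (1/(2τ)) W₂²(δ♯μ, G*) over all measurable maps δ : ℝ^d → ℝ^m has a μ-a.e. unique solution, given by the linear interpolation δ*_τ(z) = (2τ/(1+2τ)) θ̄(z) + (1/(1+2τ)) δ*(z). -/
open MeasureTheory ProbabilityTheory Filter RealInnerProductSpace
open scoped ENNReal

noncomputable section

lemma aux_glue {X Y W : Type*} [MeasurableSpace X] [MeasurableSpace Y] [MeasurableSpace W]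
    [StandardBorelSpace W] [Nonempty W]
    (μ : Measure X) [IsProbabilityMeasure μ] (δ : X → Y) (hδ : Measurable δ)
    (π : Measure (Y × W)) (h : π.map Prod.fst = μ.map δ) :
    ∃ π' : Measure (X × W), π'.map Prod.fst = μ ∧ π'.map (Prod.map δ id) = π := by
  have : IsProbabilityMeasure (μ.map δ) := Measure.isProbabilityMeasure_map hδ.aemeasurable
  have hp : IsProbabilityMeasure π := by
    constructor
    have : π.map Prod.fst Set.univ = 1 := by rw [h]; simp
    rwa [Measure.map_apply measurable_fst MeasurableSet.univ, Set.preimage_univ] at this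
  refine ⟨μ ⊗ₘ (π.condKernel.comap δ hδ), ?_, ?_⟩
  · exact Measure.fst_compProd _ _
  · ext s hs
    rw [Measure.map_apply (by fun_prop) hs, Measure.compProd_apply (by measurability)]
    conv_rhs => rw [← π.disintegrate π.condKernel]
    rw [Measure.compProd_apply hs, Measure.fst, h, lintegral_map _ hδ]
    · rfl
    · exact Kernel.measurable_kernel_prodMk_left hs

lemma aux_swap {X Y : Type*} [MeasurableSpace X] [MeasurableSpace Y]
    (μ : Measure X) (G : Measure Y) (c : X × Y → ℝ≥0∞) (hc : Measurable c)
    (π : Measure (X × Y)) [IsProbabilityMeasure π] (hπ : IsCoupling π μ G)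
    (hfin : ∫⁻ p, c p ∂π ≠ ⊤)
    (hopt : ∀ π' : Measure (X × Y), IsCoupling π' μ G → ∫⁻ p, c p ∂π ≤ ∫⁻ p, c p ∂π') :
    ∀ᵐ q ∂(π.prod π), c q.1 + c q.2 ≤ c (q.1.1, q.2.2) + c (q.2.1, q.1.2) := by
  classical
  set B : Set ((X × Y) × (X × Y)) :=
    {q | c (q.1.1, q.2.2) + c (q.2.1, q.1.2) < c q.1 + c q.2} with hB
  have hBm : MeasurableSet B := measurableSet_lt (by fun_prop) (by fun_prop)
  have hBs : ∀ q, Prod.swap q ∈ B ↔ q ∈ B := by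
    intro q
    simp only [hB, Set.mem_ofPred_eq, Prod.fst_swap, Prod.snd_swap]
    rw [add_comm (c q.2), add_comm (c (q.2.1, q.1.2))]
  have hsw : ∀ f : (X × Y) × (X × Y) → ℝ≥0∞, Measurable f →
      ∫⁻ q in B, f q ∂(π.prod π) = ∫⁻ q in B, f q.swap ∂(π.prod π) := by
    intro f hf
    rw [← lintegral_indicator hBm, ← lintegral_indicator hBm]
    conv_lhs => rw [← Measure.prod_swap]
    rw [lintegral_map (hf.indicator hBm) measurable_swap]
    refine lintegral_congr fun q => ?_
    by_cases hq : q ∈ B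
    · rw [Set.indicator_of_mem hq, Set.indicator_of_mem ((hBs q).2 hq)]
    · rw [Set.indicator_of_notMem hq, Set.indicator_of_notMem (fun h => hq ((hBs q).1 h))]
  let φ : (X × Y) × (X × Y) → X × Y := fun q => if q ∈ B then (q.1.1, q.2.2) else q.1
  have hφ : Measurable φ := Measurable.ite hBm (by fun_prop) (by fun_prop)
  have hint : ∀ f : X × Y → ℝ≥0∞, Measurable f → ∫⁻ p, f p ∂((π.prod π).map φ) =
      ∫⁻ q in B, f (q.1.1, q.2.2) ∂(π.prod π) + ∫⁻ q in Bᶜ, f q.1 ∂(π.prod π) := by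
    intro f hf
    rw [lintegral_map hf hφ, ← lintegral_add_compl _ hBm]
    congr 1
    · exact setLIntegral_congr_fun hBm (fun q hq => by simp [φ, hq])
    · exact setLIntegral_congr_fun hBm.compl (fun q hq => by
        have : q ∉ B := hq
        simp [φ, this])
  have hint1 : ∀ f : X × Y → ℝ≥0∞, Measurable f → ∫⁻ p, f p ∂π =
      ∫⁻ q in B, f q.1 ∂(π.prod π) + ∫⁻ q in Bᶜ, f q.1 ∂(π.prod π) := by
    intro f hf
    rw [lintegral_add_compl _ hBm, ← lintegral_map (f := f) hf measurable_fst]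
    simp
  have hcoup : IsCoupling ((π.prod π).map φ) μ G := by
    constructor
    · rw [← hπ.1]
      ext s hs
      rw [← lintegral_indicator_one hs, ← lintegral_indicator_one hs,
        lintegral_map (by measurability) measurable_fst,
        lintegral_map (by measurability) measurable_fst,
        hint (fun a => s.indicator 1 a.1) ((measurable_one.indicator hs).comp measurable_fst),
        hint1 (fun a => s.indicator 1 a.1) ((measurable_one.indicator hs).comp measurable_fst)]
    · rw [← hπ.2]
      ext s hs
      rw [← lintegral_indicator_one hs, ← lintegral_indicator_one hs,
        lintegral_map (by measurability) measurable_snd,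
        lintegral_map (by measurability) measurable_snd,
        hint (fun a => s.indicator 1 a.2) ((measurable_one.indicator hs).comp measurable_snd),
        hint1 (fun a => s.indicator 1 a.2) ((measurable_one.indicator hs).comp measurable_snd)]
      congr 1
      rw [hsw]
      · rfl
      · exact (measurable_one.indicator hs).comp (by fun_prop)
  have h1 := hopt _ hcoup
  rw [hint c hc, hint1 c hc] at h1
  rw [hint1 c hc] at hfin
  have hfB : ∫⁻ q in B, c q.1 ∂(π.prod π) ≠ ⊤ := fun h => hfin (by rw [h]; simp)
  have hfBc : ∫⁻ q in Bᶜ, c q.1 ∂(π.prod π) ≠ ⊤ := fun h => hfin (by rw [h]; simp)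
  have h2 : ∫⁻ q in B, c q.1 ∂(π.prod π) ≤ ∫⁻ q in B, c (q.1.1, q.2.2) ∂(π.prod π) :=
    (ENNReal.add_le_add_iff_right hfBc).1 h1
  have e1 := hsw (fun q => c q.1) (by fun_prop)
  have e2 := hsw (fun q => c (q.1.1, q.2.2)) (by fun_prop)
  simp only [Prod.fst_swap, Prod.snd_swap] at e1 e2
  have h3 : ∫⁻ q in B, (c q.1 + c q.2) ∂(π.prod π) ≤
      ∫⁻ q in B, (c (q.1.1, q.2.2) + c (q.2.1, q.1.2)) ∂(π.prod π) := by
    rw [lintegral_add_left (by fun_prop), lintegral_add_left (by fun_prop), ← e1, ← e2]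
    gcongr
  have h4 : ∫⁻ q in B, (c q.1 + c q.2) ∂(π.prod π) ≠ ⊤ := by
    rw [lintegral_add_left (by fun_prop), ← e1]
    simp [hfB]
  have h5 : (π.prod π) B = 0 := by
    by_contra hne
    have := setLIntegral_strict_mono (μ := π.prod π)
      (f := fun q => c (q.1.1, q.2.2) + c (q.2.1, q.1.2)) (g := fun q => c q.1 + c q.2) hBm hne
      (by fun_prop)
      (ne_top_of_le_ne_top h4 (setLIntegral_mono (by fun_prop) fun q hq => le_of_lt hq))
      (ae_of_all _ fun q hq => hq)
    exact absurd h3 (not_le.2 this)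
  rw [ae_iff]
  simpa [hB] using h5

lemma aux_cone {m : ℕ} (S : Set (Vec m)) (hS : IsClosed S) (v : Vec m) (hv : v ≠ 0) (c : ℝ) (hc : c < ‖v‖)
    (h : ∀ x ∈ S, ∀ y ∈ S, |⟪x - y, v⟫| ≤ c * ‖x - y‖) : (volume : Measure (Vec m)) S = 0 := by
  refine Measure.addHaar_eq_zero_of_disjoint_translates volume
    (fun n : ℕ => ((n : ℝ) + 1)⁻¹ • v) ?_ ?_ hS.measurableSet
  · rw [isBounded_iff_forall_norm_le]
    refine ⟨‖v‖, ?_⟩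
    rintro _ ⟨n, rfl⟩
    rw [norm_smul]
    have : ‖((n : ℝ) + 1)⁻¹‖ ≤ 1 := by
      rw [Real.norm_of_nonneg (by positivity)]
      exact inv_le_one_of_one_le₀ (by linarith [n.cast_nonneg (α := ℝ)])
    nlinarith [norm_nonneg v]
  · intro i j hij
    rw [Function.onFun, Set.disjoint_left]
    rintro _ ⟨a, ha, x, hx, rfl⟩ ⟨b, hb, y, hy, hxy⟩
    simp only [Set.mem_singleton_iff] at ha hb
    subst ha hb
    set t : ℝ := ((j : ℝ) + 1)⁻¹ - ((i : ℝ) + 1)⁻¹ with ht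
    have hxy' : x - y = t • v := by
      rw [ht, sub_smul]
      have : ((j : ℝ) + 1)⁻¹ • v + y = ((i : ℝ) + 1)⁻¹ • v + x := hxy
      rw [sub_eq_sub_iff_add_eq_add, add_comm, ← this, add_comm]
    have ht0 : t ≠ 0 := by
      intro h0
      apply hij
      have := sub_eq_zero.1 h0
      have := inv_injective this
      have : (j : ℝ) = i := by linarith
      exact_mod_cast this.symm
    have := h x hx y hy
    rw [hxy', inner_smul_left, real_inner_self_eq_norm_sq, norm_smul, abs_mul] at this
    simp only [conj_trivial, abs_pow, abs_norm, Real.norm_eq_abs] at this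
    have h1 : 0 < |t| := abs_pos.2 ht0
    have h2 : 0 < ‖v‖ := norm_pos_iff.2 hv
    have h3 : 0 < |t| * ‖v‖ := by positivity
    nlinarith

lemma aux_sq {E : Type*} [NormedAddCommGroup E] [InnerProductSpace ℝ E] (x1 x2 y1 y2 : E)
    (h : ENNReal.ofReal (‖x1 - y1‖ ^ 2) + ENNReal.ofReal (‖x2 - y2‖ ^ 2) ≤
      ENNReal.ofReal (‖x1 - y2‖ ^ 2) + ENNReal.ofReal (‖x2 - y1‖ ^ 2)) :
    0 ≤ ⟪x1 - x2, y1 - y2⟫ := by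
  rw [← ENNReal.ofReal_add (by positivity) (by positivity),
    ← ENNReal.ofReal_add (by positivity) (by positivity),
    ENNReal.ofReal_le_ofReal_iff (by positivity)] at h
  simp only [norm_sub_sq_real] at h
  simp only [inner_sub_left, inner_sub_right]
  linarith

lemma aux_bd {E : Type*} [NormedAddCommGroup E] [InnerProductSpace ℝ E] (h a b t1 t2 : E)
    (ε : ℝ) (h1 : ‖t1 - a‖ ≤ ε) (h2 : ‖t2 - b‖ ≤ ε) (h0 : 0 ≤ ⟪h, t1 - t2⟫) :
    - (2 * ε * ‖h‖) ≤ ⟪h, a - b⟫ := by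
  have e : ⟪h, t1 - t2⟫ = ⟪h, a - b⟫ + ⟪h, t1 - a⟫ - ⟪h, t2 - b⟫ := by
    simp only [inner_sub_right]; ring
  have a1 := abs_le.1 (abs_real_inner_le_norm h (t1 - a))
  have a2 := abs_le.1 (abs_real_inner_le_norm h (t2 - b))
  have b1 := mul_le_mul_of_nonneg_left h1 (norm_nonneg h)
  have b2 := mul_le_mul_of_nonneg_left h2 (norm_nonneg h)
  linarith [a1.1, a1.2, a2.1, a2.2]

lemma aux_unique {X : Type*} [MeasurableSpace X] {m : ℕ}
    (μ : Measure X) [IsProbabilityMeasure μ] (G : Measure (Vec m))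
    (x : X → Vec m) (hx : Measurable x) (hac : μ.map x ≪ (volume : Measure (Vec m)))
    (T1 T2 : X → Vec m) (hT1 : Measurable T1) (hT2 : Measurable T2)
    (hp1 : μ.map T1 = G) (hp2 : μ.map T2 = G) (OT : ℝ≥0∞) (hOT : OT ≠ ⊤)
    (hc1 : ∫⁻ z, ENNReal.ofReal (‖x z - T1 z‖ ^ 2) ∂μ ≤ OT)
    (hc2 : ∫⁻ z, ENNReal.ofReal (‖x z - T2 z‖ ^ 2) ∂μ ≤ OT)
    (hopt : ∀ π' : Measure (X × Vec m), IsCoupling π' μ G →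
      OT ≤ ∫⁻ p, ENNReal.ofReal (‖x p.1 - p.2‖ ^ 2) ∂π') :
    T1 =ᵐ[μ] T2 := by
  set π1 := μ.map (fun z => (z, T1 z)) with hπ1
  set π2 := μ.map (fun z => (z, T2 z)) with hπ2
  have m1 : Measurable (fun z => (z, T1 z)) := by fun_prop
  have m2 : Measurable (fun z => (z, T2 z)) := by fun_prop
  have : IsProbabilityMeasure π1 := Measure.isProbabilityMeasure_map m1.aemeasurable
  have : IsProbabilityMeasure π2 := Measure.isProbabilityMeasure_map m2.aemeasurable
  have h2 : (2⁻¹ : ℝ≥0∞) + 2⁻¹ = 1 := ENNReal.inv_two_add_inv_two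
  set π := (2⁻¹ : ℝ≥0∞) • π1 + (2⁻¹ : ℝ≥0∞) • π2 with hπ
  have : IsProbabilityMeasure π := ⟨by simp [hπ, h2]⟩
  have c1f : π1.map Prod.fst = μ := by
    rw [hπ1, Measure.map_map measurable_fst m1]; exact Measure.map_id
  have c2f : π2.map Prod.fst = μ := by
    rw [hπ2, Measure.map_map measurable_fst m2]; exact Measure.map_id
  have c1s : π1.map Prod.snd = G := by
    rw [hπ1, Measure.map_map measurable_snd m1]; exact hp1
  have c2s : π2.map Prod.snd = G := by
    rw [hπ2, Measure.map_map measurable_snd m2]; exact hp2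
  have hcoup : IsCoupling π μ G := by
    constructor
    · rw [hπ, Measure.map_add _ _ measurable_fst, Measure.map_smul, Measure.map_smul, c1f, c2f,
        ← add_smul, h2, one_smul]
    · rw [hπ, Measure.map_add _ _ measurable_snd, Measure.map_smul, Measure.map_smul, c1s, c2s,
        ← add_smul, h2, one_smul]
  have hcm : Measurable (fun p : X × Vec m => ENNReal.ofReal (‖x p.1 - p.2‖ ^ 2)) := by fun_prop
  have hcost : ∫⁻ p, ENNReal.ofReal (‖x p.1 - p.2‖ ^ 2) ∂π ≤ OT := by
    rw [hπ, lintegral_add_measure, lintegral_smul_measure, lintegral_smul_measure,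
      hπ1, hπ2, lintegral_map hcm m1, lintegral_map hcm m2]
    calc _ ≤ (2⁻¹ : ℝ≥0∞) • OT + (2⁻¹ : ℝ≥0∞) • OT := by
          gcongr
      _ = OT := by rw [← add_smul, h2, one_smul]
  have hswap := aux_swap μ G _ hcm π hcoup (ne_top_of_le_ne_top hOT hcost)
    (fun π' h' => hcost.trans (hopt π' h'))
  have hac1 : π1 ≪ π := by
    rw [hπ]
    refine Measure.AbsolutelyContinuous.add_right ?_ _
    exact Measure.absolutelyContinuous_smul (by simp)
  have hac2 : π2 ≪ π := by
    rw [hπ, add_comm]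
    refine Measure.AbsolutelyContinuous.add_right ?_ _
    exact Measure.absolutelyContinuous_smul (by simp)
  have hmono : ∀ᵐ q ∂(μ.prod μ), 0 ≤ ⟪x q.1 - x q.2, T1 q.1 - T2 q.2⟫ := by
    have h3 := (hac1.prod hac2).ae_le hswap
    rw [hπ1, hπ2, Measure.map_prod_map _ _ m1 m2] at h3
    have h4 := ae_of_ae_map (by fun_prop) h3
    filter_upwards [h4] with q hq
    exact aux_sq _ _ _ _ hq
  have hmono' : ∀ᵐ q ∂(μ.prod μ), 0 ≤ ⟪x q.2 - x q.1, T1 q.2 - T2 q.1⟫ := by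
    have := hmono
    rw [← Measure.prod_swap] at this
    exact ae_of_ae_map (f := Prod.swap) (by fun_prop) this
  -- the main null set claim
  have key : ∀ (a b : Vec m) (ε : ℝ), 2 * ε < ‖a - b‖ → a ≠ b →
      μ {z | ‖T1 z - a‖ ≤ ε ∧ ‖T2 z - b‖ ≤ ε} = 0 := by
    intro a b ε hε hab
    set A : Set X := {z | ‖T1 z - a‖ ≤ ε ∧ ‖T2 z - b‖ ≤ ε} with hA
    have hAm : MeasurableSet A := by
      have e1 : MeasurableSet {z | ‖T1 z - a‖ ≤ ε} := measurableSet_le (by fun_prop) (by fun_prop)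
      have e2 : MeasurableSet {z | ‖T2 z - b‖ ≤ ε} := measurableSet_le (by fun_prop) (by fun_prop)
      exact e1.inter e2
    set ν := (μ.restrict A).map x with hν
    have : IsFiniteMeasure ν := by rw [hν]; infer_instance
    set C : Set (Vec m × Vec m) := {p | |⟪p.1 - p.2, a - b⟫| ≤ (2 * ε) * ‖p.1 - p.2‖} with hC
    have hCc : IsClosed C := isClosed_le (by fun_prop) (by fun_prop)
    have hνC : ∀ᵐ p ∂(ν.prod ν), p ∈ C := by
      rw [hν, Measure.map_prod_map _ _ hx hx, ae_map_iff (p := fun p => p ∈ C) (by fun_prop) hCc.measurableSet,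
        Measure.prod_restrict, ae_restrict_iff' (hAm.prod hAm)]
      filter_upwards [hmono, hmono'] with q h1 h2 hq
      have k1 := aux_bd _ a b _ _ ε hq.1.1 hq.2.2 h1
      have k2 := aux_bd _ a b _ _ ε hq.2.1 hq.1.2 h2
      have : x q.2 - x q.1 = -(x q.1 - x q.2) := by abel
      rw [this, inner_neg_left, norm_neg] at k2
      exact abs_le.2 ⟨k1, by simpa using by linarith⟩
    have hsupp : ∀ y ∈ ν.support, ∀ y' ∈ ν.support, (y, y') ∈ C := by
      intro y hy y' hy'
      by_contra hn
      have hU : Cᶜ ∈ nhds (y, y') := hCc.isOpen_compl.mem_nhds hn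
      rw [nhds_prod_eq, Filter.mem_prod_iff] at hU
      obtain ⟨U, hU, V, hV, hUV⟩ := hU
      have p1 := (Measure.mem_support_iff_forall y).1 hy U hU
      have p2 := (Measure.mem_support_iff_forall y').1 hy' V hV
      have : ν.prod ν (U ×ˢ V) = 0 := measure_mono_null hUV hνC
      rw [Measure.prod_prod] at this
      exact (mul_ne_zero p1.ne' p2.ne') this
    have h0 := aux_cone ν.support Measure.isClosed_support (a - b) (sub_ne_zero.2 hab) (2 * ε) hε
      (fun y hy y' hy' => hsupp y hy y' hy')
    have h1 : ν ν.support = 0 := by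
      have hle : ν ≪ μ.map x := (Measure.absolutelyContinuous_of_le Measure.restrict_le_self).map hx
      exact hle (hac h0)
    have h2 : ν Set.univ = 0 := by
      rw [← Set.union_compl_self ν.support]
      exact measure_union_null h1 Measure.measure_compl_support
    rw [hν, Measure.map_apply hx MeasurableSet.univ] at h2
    simpa using h2
  have hcover : {z | ¬ T1 z = T2 z} ⊆ ⋃ i : ℕ, ⋃ j : ℕ, ⋃ k : ℕ,
      {z | (2 * (1 / ((k : ℝ) + 1)) < ‖TopologicalSpace.denseSeq (Vec m) i - TopologicalSpace.denseSeq (Vec m) j‖) ∧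
        ‖T1 z - TopologicalSpace.denseSeq (Vec m) i‖ ≤ 1 / ((k : ℝ) + 1) ∧
        ‖T2 z - TopologicalSpace.denseSeq (Vec m) j‖ ≤ 1 / ((k : ℝ) + 1)} := by
    intro z hz
    have hpos : 0 < ‖T1 z - T2 z‖ / 8 := by
      have := norm_pos_iff.2 (sub_ne_zero.2 hz)
      positivity
    obtain ⟨k, hk⟩ := exists_nat_one_div_lt hpos
    have hkp : 0 < 1 / ((k : ℝ) + 1) := by positivity
    obtain ⟨i, hi⟩ := (TopologicalSpace.denseRange_denseSeq (Vec m)).exists_dist_lt (T1 z) hkp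
    obtain ⟨j, hj⟩ := (TopologicalSpace.denseRange_denseSeq (Vec m)).exists_dist_lt (T2 z) hkp
    rw [dist_eq_norm] at hi hj
    simp only [Set.mem_iUnion]
    refine ⟨i, j, k, ?_, hi.le, hj.le⟩
    set a := TopologicalSpace.denseSeq (Vec m) i
    set b := TopologicalSpace.denseSeq (Vec m) j
    have : ‖T1 z - T2 z‖ ≤ ‖T1 z - a‖ + ‖a - b‖ + ‖T2 z - b‖ := by
      calc ‖T1 z - T2 z‖ = ‖(T1 z - a) + (a - b) - (T2 z - b)‖ := by congr 1; abel
        _ ≤ ‖(T1 z - a) + (a - b)‖ + ‖T2 z - b‖ := norm_sub_le _ _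
        _ ≤ _ := by gcongr; exact norm_add_le _ _
    linarith
  refine measure_mono_null hcover ?_
  refine measure_iUnion_null fun i => measure_iUnion_null fun j => measure_iUnion_null fun k => ?_
  by_cases hlt : 2 * (1 / ((k : ℝ) + 1)) < ‖TopologicalSpace.denseSeq (Vec m) i - TopologicalSpace.denseSeq (Vec m) j‖
  · refine measure_mono_null (fun z hz => hz.2) (key _ _ _ hlt ?_)
    intro h
    rw [h, sub_self, norm_zero] at hlt
    have : 0 < 2 * (1 / ((k : ℝ) + 1)) := by positivity
    linarith
  · refine measure_mono_null (fun z hz => (hlt hz.1).elim) (measure_empty (μ := μ))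

lemma aux_lim {X : Type*} [MeasurableSpace X] {m : ℕ}
    (μ : Measure X) [IsProbabilityMeasure μ] (G : Measure (Vec m)) [IsProbabilityMeasure G]
    (T : X → Vec m) (hT : Measurable T)
    (h : ∀ ε : ℝ≥0∞, ε ≠ 0 → ∃ π : Measure (X × Vec m), IsCoupling π μ G ∧
      ∫⁻ p, ENNReal.ofReal (‖T p.1 - p.2‖ ^ 2) ∂π ≤ ε) : μ.map T = G := by
  have : IsProbabilityMeasure (μ.map T) := Measure.isProbabilityMeasure_map hT.aemeasurable
  have hLP : levyProkhorovEDist (μ.map T) G = 0 := by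
    rw [← nonpos_iff_eq_zero]
    refine levyProkhorovEDist_le_of_forall_le _ _ 0 ?_
    intro η B hη hηt hB
    have hr : 0 < η.toReal := ENNReal.toReal_pos hη.ne' hηt.ne
    set r := η.toReal
    have hr2 : ENNReal.ofReal (r ^ 2) ≠ 0 := by
      simp only [ne_eq, ENNReal.ofReal_eq_zero, not_le]; positivity
    obtain ⟨π, hπ, hc⟩ := h (ENNReal.ofReal (r ^ 2) * η) (mul_ne_zero hr2 hη.ne')
    rw [Measure.map_apply hT hB, ← hπ.1, Measure.map_apply measurable_fst (hT hB)]
    have hbad : π {p | ENNReal.ofReal (r ^ 2) ≤ ENNReal.ofReal (‖T p.1 - p.2‖ ^ 2)} ≤ η := by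
      have := (mul_meas_ge_le_lintegral (μ := π)
        (f := fun p => ENNReal.ofReal (‖T p.1 - p.2‖ ^ 2)) (by fun_prop)
        (ENNReal.ofReal (r ^ 2))).trans hc
      exact (ENNReal.mul_le_mul_iff_right hr2 ENNReal.ofReal_ne_top).1 this
    have hgood : π (Prod.snd ⁻¹' Metric.thickening r B) = G (Metric.thickening r B) := by
      rw [← hπ.2, Measure.map_apply measurable_snd Metric.isOpen_thickening.measurableSet]
    calc _ ≤ π (Prod.snd ⁻¹' Metric.thickening r B ∪
          {p | ENNReal.ofReal (r ^ 2) ≤ ENNReal.ofReal (‖T p.1 - p.2‖ ^ 2)}) := by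
          refine measure_mono ?_
          intro p hp
          by_cases hlt : ‖T p.1 - p.2‖ < r
          · left
            refine Metric.mem_thickening_iff.2 ⟨T p.1, hp, ?_⟩
            rw [dist_comm, dist_eq_norm]; exact hlt
          · right
            push Not at hlt
            exact ENNReal.ofReal_le_ofReal (by gcongr)
      _ ≤ _ := measure_union_le _ _
      _ ≤ _ := by rw [hgood]; gcongr
  refine ext_of_generate_finite _ ?_ isPiSystem_isClosed (fun A hA ↦ ?_) (by simp)
  · rw [BorelSpace.measurable_eq (α := Vec m), borel_eq_generateFrom_isClosed]
  exact measure_eq_measure_of_levyProkhorovEDist_eq_zero_of_isClosed hLP hA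
    ⟨1, Real.zero_lt_one, measure_ne_top _ _⟩ ⟨1, Real.zero_lt_one, measure_ne_top _ _⟩

lemma aux_young {E : Type*} [NormedAddCommGroup E] (x t y : E) (s : ℝ) (hs : 0 < s) :
    ENNReal.ofReal (‖x - t‖ ^ 2) ≤ ENNReal.ofReal (1 + s) * ENNReal.ofReal (‖x - y‖ ^ 2) +
      ENNReal.ofReal (1 + 1 / s) * ENNReal.ofReal (‖t - y‖ ^ 2) := by
  rw [← ENNReal.ofReal_mul (by positivity), ← ENNReal.ofReal_mul (by positivity),
    ← ENNReal.ofReal_add (by positivity) (by positivity)]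
  apply ENNReal.ofReal_le_ofReal
  have h1 : ‖x - t‖ ≤ ‖x - y‖ + ‖t - y‖ := by
    have : x - t = (x - y) - (t - y) := by abel
    rw [this]; exact norm_sub_le _ _
  have h2 : ‖x - t‖ ^ 2 ≤ (‖x - y‖ + ‖t - y‖) ^ 2 := by gcongr
  refine h2.trans ?_
  set a := ‖x - y‖
  set b := ‖t - y‖
  have : (1 + s) * a ^ 2 + (1 + 1 / s) * b ^ 2 - (a + b) ^ 2 = (s * a - b) ^ 2 / s := by
    field_simp; ring
  have h3 : 0 ≤ (s * a - b) ^ 2 / s := by positivity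
  linarith

lemma aux_close {X : Type*} [MeasurableSpace X] {m : ℕ}
    (μ : Measure X) (G : Measure (Vec m))
    (x T : X → Vec m) (hx : Measurable x) (hT : Measurable T) (OT : ℝ≥0∞) (hOT : OT ≠ ⊤)
    (h : ∀ ε : ℝ≥0∞, ε ≠ 0 → ∃ π : Measure (X × Vec m), IsCoupling π μ G ∧
      ∫⁻ p, ENNReal.ofReal (‖T p.1 - p.2‖ ^ 2) ∂π ≤ ε ∧
      ∫⁻ p, ENNReal.ofReal (‖x p.1 - p.2‖ ^ 2) ∂π ≤ OT + ε) :
    ∫⁻ z, ENNReal.ofReal (‖x z - T z‖ ^ 2) ∂μ ≤ OT := by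
  have key : ∀ s : ℝ, 0 < s → ∫⁻ z, ENNReal.ofReal (‖x z - T z‖ ^ 2) ∂μ ≤
      ENNReal.ofReal ((1 + s) * (OT.toReal + s ^ 2) + (s ^ 2 + s)) := by
    intro s hs
    obtain ⟨π, hπ, hA, hB⟩ := h (ENNReal.ofReal (s ^ 2)) (by
      simp only [ne_eq, ENNReal.ofReal_eq_zero, not_le]; positivity)
    rw [← hπ.1, lintegral_map (by fun_prop) measurable_fst]
    calc _ ≤ ∫⁻ p, (ENNReal.ofReal (1 + s) * ENNReal.ofReal (‖x p.1 - p.2‖ ^ 2) +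
            ENNReal.ofReal (1 + 1 / s) * ENNReal.ofReal (‖T p.1 - p.2‖ ^ 2)) ∂π :=
          lintegral_mono fun p => aux_young _ _ _ s hs
      _ = ENNReal.ofReal (1 + s) * ∫⁻ p, ENNReal.ofReal (‖x p.1 - p.2‖ ^ 2) ∂π +
            ENNReal.ofReal (1 + 1 / s) * ∫⁻ p, ENNReal.ofReal (‖T p.1 - p.2‖ ^ 2) ∂π := by
          rw [lintegral_add_left (by fun_prop), lintegral_const_mul _ (by fun_prop),
            lintegral_const_mul _ (by fun_prop)]
      _ ≤ ENNReal.ofReal (1 + s) * (OT + ENNReal.ofReal (s ^ 2)) +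
            ENNReal.ofReal (1 + 1 / s) * ENNReal.ofReal (s ^ 2) := by gcongr
      _ = _ := by
          conv_lhs => rw [← ENNReal.ofReal_toReal hOT]
          have := ENNReal.toReal_nonneg (a := OT)
          rw [← ENNReal.ofReal_add this (by positivity), ← ENNReal.ofReal_mul (by positivity),
            ← ENNReal.ofReal_mul (by positivity), ← ENNReal.ofReal_add (by positivity)
            (by positivity)]
          congr 1
          field_simp
  have hlim : Tendsto (fun s : ℝ => ENNReal.ofReal ((1 + s) * (OT.toReal + s ^ 2) + (s ^ 2 + s)))
      (nhdsWithin 0 (Set.Ioi 0)) (nhds OT) := by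
    have hc : Continuous
        (fun s : ℝ => ENNReal.ofReal ((1 + s) * (OT.toReal + s ^ 2) + (s ^ 2 + s))) :=
      ENNReal.continuous_ofReal.comp (by fun_prop)
    have := (hc.tendsto 0).mono_left (nhdsWithin_le_nhds (s := Set.Ioi 0))
    simpa [ENNReal.ofReal_toReal hOT] using this
  exact ge_of_tendsto hlim (by filter_upwards [self_mem_nhdsWithin] with s hs using key s hs)

lemma aux_memLp {X : Type*} [MeasurableSpace X] {m : ℕ} (P : Measure X)
    (f : X → Vec m) (hf : Measurable f) :
    MemLp f 2 P ↔ ∫⁻ p, ENNReal.ofReal (‖f p‖ ^ 2) ∂P < ⊤ := by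
  rw [memLp_two_iff_integrable_sq_norm hf.aestronglyMeasurable, Integrable,
    hasFiniteIntegral_iff_ofReal (ae_of_all _ fun _ => by positivity)]
  exact and_iff_right (by fun_prop)

lemma aux_inner {X : Type*} [MeasurableSpace X] {m : ℕ} (P : Measure X)
    (f g : X → Vec m) (hf : MemLp f 2 P) (hg : MemLp g 2 P) :
    Integrable (fun p => ⟪f p, g p⟫) P := by
  have h : Integrable (fun p => ‖f p‖ * ‖g p‖) P := hf.norm.integrable_mul hg.norm
  exact h.mono' (hf.1.inner hg.1) (ae_of_all _ fun p => norm_inner_le_norm _ _)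

lemma aux_pyth {d m : ℕ} (P : Measure (Vec d × Vec m)) [IsProbabilityMeasure P]
    (θbar : Vec d → Vec m) (hθbar : IsPosteriorMean P θbar)
    (hA1 : ∫⁻ p, ENNReal.ofReal (‖p.2‖ ^ 2) ∂P < ⊤) :
    ∫⁻ p, ENNReal.ofReal (‖θbar p.1 - p.2‖ ^ 2) ∂P < ⊤ ∧
    ∀ δ : Vec d → Vec m, Measurable δ →
      ∫⁻ p, ENNReal.ofReal (‖δ p.1 - p.2‖ ^ 2) ∂P =
        ∫⁻ p, ENNReal.ofReal (‖δ p.1 - θbar p.1‖ ^ 2) ∂P +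
        ∫⁻ p, ENNReal.ofReal (‖θbar p.1 - p.2‖ ^ 2) ∂P := by
  obtain ⟨hθm, hθ⟩ := hθbar
  have hΘ : MemLp (fun p : Vec d × Vec m => p.2) 2 P := (aux_memLp P _ (by fun_prop)).2 hA1
  have hθ2 : MemLp (fun p : Vec d × Vec m => θbar p.1) 2 P :=
    (memLp_congr_ae hθ).2 (hΘ.condExp (by norm_num))
  have hg : MemLp (fun p : Vec d × Vec m => θbar p.1 - p.2) 2 P := hθ2.sub hΘ
  refine ⟨(aux_memLp P _ (by fun_prop)).1 hg, ?_⟩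
  intro δ hδ
  by_cases hδ2 : MemLp (fun p : Vec d × Vec m => δ p.1) 2 P
  · have hf : MemLp (fun p : Vec d × Vec m => δ p.1 - θbar p.1) 2 P := hδ2.sub hθ2
    have hd : MemLp (fun p : Vec d × Vec m => δ p.1 - p.2) 2 P := hδ2.sub hΘ
    have i1 := (memLp_two_iff_integrable_sq_norm hf.1).1 hf
    have i2 := (memLp_two_iff_integrable_sq_norm hg.1).1 hg
    have i3 := (memLp_two_iff_integrable_sq_norm hd.1).1 hd
    rw [← ofReal_integral_eq_lintegral_ofReal i1 (ae_of_all _ fun _ => by positivity),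
      ← ofReal_integral_eq_lintegral_ofReal i2 (ae_of_all _ fun _ => by positivity),
      ← ofReal_integral_eq_lintegral_ofReal i3 (ae_of_all _ fun _ => by positivity),
      ← ENNReal.ofReal_add (integral_nonneg fun _ => by positivity)
        (integral_nonneg fun _ => by positivity)]
    congr 1
    have j1 : Integrable (fun p : Vec d × Vec m => ⟪δ p.1 - θbar p.1, θbar p.1⟫) P :=
      aux_inner P _ _ hf hθ2
    have j2 : Integrable (fun p : Vec d × Vec m => ⟪δ p.1 - θbar p.1, p.2⟫) P :=
      aux_inner P _ _ hf hΘ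
    have horth : ∫ p, ⟪δ p.1 - θbar p.1, p.2⟫ ∂P = ∫ p, ⟪δ p.1 - θbar p.1, θbar p.1⟫ ∂P := by
      have hm : MeasurableSpace.comap Prod.fst inferInstance ≤
        (inferInstance : MeasurableSpace (Vec d × Vec m)) := measurable_fst.comap_le
      rw [← integral_condExp hm]
      apply integral_congr_ae
      have hsm : StronglyMeasurable[MeasurableSpace.comap Prod.fst inferInstance]
          (fun p : Vec d × Vec m => δ p.1 - θbar p.1) :=
        ((hδ.sub hθm).comp (comap_measurable Prod.fst)).stronglyMeasurable
      have := condExp_bilin_of_stronglyMeasurable_left (innerSL ℝ) hsm (μ := P)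
        (g := fun p : Vec d × Vec m => p.2) j2 (hΘ.integrable (by norm_num))
      refine this.trans ?_
      filter_upwards [hθ] with p hp
      rw [← hp]; rfl
    have e : ∀ p : Vec d × Vec m, ‖δ p.1 - p.2‖ ^ 2 =
        (‖δ p.1 - θbar p.1‖ ^ 2 + ‖θbar p.1 - p.2‖ ^ 2) +
        2 * (⟪δ p.1 - θbar p.1, θbar p.1⟫ - ⟪δ p.1 - θbar p.1, p.2⟫) := by
      intro p
      have : δ p.1 - p.2 = (δ p.1 - θbar p.1) + (θbar p.1 - p.2) := by abel
      rw [this, norm_add_sq_real, ← inner_sub_right]; ring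
    simp_rw [e]
    have i12 : Integrable (fun p : Vec d × Vec m =>
      ‖δ p.1 - θbar p.1‖ ^ 2 + ‖θbar p.1 - p.2‖ ^ 2) P := i1.add i2
    have j12 : Integrable (fun p : Vec d × Vec m =>
      2 * (⟪δ p.1 - θbar p.1, θbar p.1⟫ - ⟪δ p.1 - θbar p.1, p.2⟫)) P := (j1.sub j2).const_mul 2
    rw [integral_add i12 j12, integral_add i1 i2,
      integral_const_mul, integral_sub j1 j2, horth]
    ring
  · have h1 : ∫⁻ p, ENNReal.ofReal (‖δ p.1 - p.2‖ ^ 2) ∂P = ⊤ := by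
      by_contra hne
      have := (aux_memLp P (fun p : Vec d × Vec m => δ p.1 - p.2) (by fun_prop)).2
        (lt_top_iff_ne_top.2 hne)
      apply hδ2
      simpa [Pi.add_def] using this.add hΘ
    have h2 : ∫⁻ p, ENNReal.ofReal (‖δ p.1 - θbar p.1‖ ^ 2) ∂P = ⊤ := by
      by_contra hne
      have := (aux_memLp P (fun p : Vec d × Vec m => δ p.1 - θbar p.1) (by fun_prop)).2
        (lt_top_iff_ne_top.2 hne)
      apply hδ2
      simpa [Pi.add_def] using this.add hθ2
    rw [h1, h2, top_add]

lemma aux_id {E : Type*} [NormedAddCommGroup E] [InnerProductSpace ℝ E] (d x y : E) (a : ℝ)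
    (ha : 0 < a) :
    ENNReal.ofReal (‖d - x‖ ^ 2) + ENNReal.ofReal (1 / a) * ENNReal.ofReal (‖d - y‖ ^ 2) =
      ENNReal.ofReal (1 / (a * (1 + a))) * ENNReal.ofReal (‖((1 + a) • d - a • x) - y‖ ^ 2) +
      ENNReal.ofReal (1 / (1 + a)) * ENNReal.ofReal (‖x - y‖ ^ 2) := by
  rw [← ENNReal.ofReal_mul (by positivity), ← ENNReal.ofReal_mul (by positivity),
    ← ENNReal.ofReal_mul (by positivity), ← ENNReal.ofReal_add (by positivity) (by positivity),
    ← ENNReal.ofReal_add (by positivity) (by positivity)]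
  congr 1
  have e1 : ((1 + a) • d - a • x) - y = a • (d - x) + (d - y) := by module
  have e2 : x - y = (d - y) - (d - x) := by abel
  rw [e1, e2]
  generalize d - x = u
  generalize d - y = v
  rw [norm_add_sq_real, norm_sub_sq_real, inner_smul_left, norm_smul, mul_pow, real_inner_comm u v]
  simp only [Real.norm_eq_abs, sq_abs, conj_trivial]
  field_simp
  ring

lemma aux_obj {X : Type*} [MeasurableSpace X] {m : ℕ} (μ : Measure X) [IsProbabilityMeasure μ]
    (G : Measure (Vec m)) (x δ : X → Vec m) (hx : Measurable x) (hδ : Measurable δ)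
    (a : ℝ) (ha : 0 < a) :
    (∀ π : Measure (X × Vec m), IsCoupling π μ G →
      ∫⁻ z, ENNReal.ofReal (‖δ z - x z‖ ^ 2) ∂μ + ENNReal.ofReal (1 / a) * W2sq (μ.map δ) G ≤
      ENNReal.ofReal (1 / (a * (1 + a))) *
        ∫⁻ p, ENNReal.ofReal (‖((1 + a) • δ p.1 - a • x p.1) - p.2‖ ^ 2) ∂π +
      ENNReal.ofReal (1 / (1 + a)) * ∫⁻ p, ENNReal.ofReal (‖x p.1 - p.2‖ ^ 2) ∂π) ∧
    (∀ r : ℝ≥0∞, ∫⁻ z, ENNReal.ofReal (‖δ z - x z‖ ^ 2) ∂μ +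
        ENNReal.ofReal (1 / a) * W2sq (μ.map δ) G < r →
      ∃ π : Measure (X × Vec m), IsCoupling π μ G ∧
      ENNReal.ofReal (1 / (a * (1 + a))) *
        ∫⁻ p, ENNReal.ofReal (‖((1 + a) • δ p.1 - a • x p.1) - p.2‖ ^ 2) ∂π +
      ENNReal.ofReal (1 / (1 + a)) * ∫⁻ p, ENNReal.ofReal (‖x p.1 - p.2‖ ^ 2) ∂π < r) := by
  have hid : ∀ π : Measure (X × Vec m), IsCoupling π μ G →
      ∫⁻ z, ENNReal.ofReal (‖δ z - x z‖ ^ 2) ∂μ + ENNReal.ofReal (1 / a) *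
        ∫⁻ p, ENNReal.ofReal (‖p.1 - p.2‖ ^ 2) ∂(π.map (Prod.map δ id)) =
      ENNReal.ofReal (1 / (a * (1 + a))) *
        ∫⁻ p, ENNReal.ofReal (‖((1 + a) • δ p.1 - a • x p.1) - p.2‖ ^ 2) ∂π +
      ENNReal.ofReal (1 / (1 + a)) * ∫⁻ p, ENNReal.ofReal (‖x p.1 - p.2‖ ^ 2) ∂π := by
    intro π hπ
    conv_lhs => rw [← hπ.1]
    rw [lintegral_map (by fun_prop) measurable_fst, lintegral_map (by fun_prop) (by fun_prop),
      ← lintegral_const_mul _ (by fun_prop), ← lintegral_const_mul _ (by fun_prop),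
      ← lintegral_const_mul _ (by fun_prop), ← lintegral_add_left (by fun_prop),
      ← lintegral_add_left (by fun_prop)]
    exact lintegral_congr fun p => aux_id _ _ _ a ha
  have ha' : ENNReal.ofReal (1 / a) ≠ 0 := by
    simp only [ne_eq, ENNReal.ofReal_eq_zero, not_le]; positivity
  constructor
  · intro π hπ
    rw [← hid π hπ]
    gcongr
    refine iInf₂_le (π.map (Prod.map δ id)) ⟨?_, ?_⟩
    · rw [Measure.map_map measurable_fst (by fun_prop), ← hπ.1,
        Measure.map_map hδ measurable_fst]; rfl
    · rw [Measure.map_map measurable_snd (by fun_prop), ← hπ.2]; rfl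
  · intro r hr
    by_contra! hcon
    refine absurd hr (not_lt.2 ?_)
    rw [← tsub_le_iff_left, mul_comm, ← ENNReal.div_le_iff ha' ENNReal.ofReal_ne_top]
    refine le_iInf₂ fun π hπ => ?_
    rw [ENNReal.div_le_iff ha' ENNReal.ofReal_ne_top, mul_comm, tsub_le_iff_left]
    obtain ⟨π', h1, h2⟩ := aux_glue μ δ hδ π hπ.1
    have hc : IsCoupling π' μ G := by
      refine ⟨h1, ?_⟩
      rw [← hπ.2, ← h2, Measure.map_map measurable_snd (by fun_prop)]; rfl
    have := hcon π' hc
    rwa [← hid π' hc, h2] at this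

/-- Under Assumptions 1 and 2, for every `τ > 0` the penalized problem of
minimizing `E_P[‖δ(Z) − Θ‖²] + (1/(2τ)) W₂²(δ♯μ, G*)` over measurable `δ` has a `μ`-a.e.
unique solution, given by `δ*_τ = (2τ/(1+2τ)) θ̄ + (1/(1+2τ)) δ*`. -/
theorem stmt2 {d m : ℕ}
    (P : Measure (Vec d × Vec m)) [IsProbabilityMeasure P]
    (μ : Measure (Vec d)) (G : Measure (Vec m))
    (hμ : μ = P.map Prod.fst) (hG : G = P.map Prod.snd)
    (θbar : Vec d → Vec m) (hθbar : IsPosteriorMean P θbar)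
    -- Assumption 1
    (hA1 : ∫⁻ θ, ENNReal.ofReal (‖θ‖ ^ 2) ∂G < ⊤)
    -- Assumption 2
    (hA2 : (μ.map θbar) ≪ (volume : Measure (Vec m)))
    -- `δ*` is the OT-based denoiser
    (δstar : Vec d → Vec m) (hδmeas : Measurable δstar) (hδpush : μ.map δstar = G)
    (hδmin : ∀ π : Measure (Vec d × Vec m), IsCoupling π μ G →
      ∫⁻ p, ENNReal.ofReal (‖θbar p.1 - p.2‖ ^ 2) ∂(μ.map fun z => (z, δstar z)) ≤
        ∫⁻ p, ENNReal.ofReal (‖θbar p.1 - p.2‖ ^ 2) ∂π)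
    (τ : ℝ) (hτ : 0 < τ) :
    -- `δ*_τ` minimizes the penalized objective over all measurable maps …
    (∀ δ : Vec d → Vec m, Measurable δ →
      (∫⁻ p, ENNReal.ofReal
          (‖((2 * τ / (1 + 2 * τ)) • θbar p.1 + (1 / (1 + 2 * τ)) • δstar p.1) - p.2‖ ^ 2) ∂P +
        ENNReal.ofReal (1 / (2 * τ)) *
          W2sq (μ.map fun z => (2 * τ / (1 + 2 * τ)) • θbar z + (1 / (1 + 2 * τ)) • δstar z) G) ≤
      (∫⁻ p, ENNReal.ofReal (‖δ p.1 - p.2‖ ^ 2) ∂P +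
        ENNReal.ofReal (1 / (2 * τ)) * W2sq (μ.map δ) G)) ∧
    -- … and is its `μ`-a.e. unique minimizer
    (∀ δ : Vec d → Vec m, Measurable δ →
      ((∫⁻ p, ENNReal.ofReal (‖δ p.1 - p.2‖ ^ 2) ∂P +
          ENNReal.ofReal (1 / (2 * τ)) * W2sq (μ.map δ) G) =
        (∫⁻ p, ENNReal.ofReal
            (‖((2 * τ / (1 + 2 * τ)) • θbar p.1 + (1 / (1 + 2 * τ)) • δstar p.1) - p.2‖ ^ 2) ∂P +
          ENNReal.ofReal (1 / (2 * τ)) *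
            W2sq (μ.map fun z => (2 * τ / (1 + 2 * τ)) • θbar z + (1 / (1 + 2 * τ)) • δstar z) G)) →
      δ =ᵐ[μ] fun z => (2 * τ / (1 + 2 * τ)) • θbar z + (1 / (1 + 2 * τ)) • δstar z) := by
  obtain ⟨a, ha⟩ : ∃ a, a = 2 * τ := ⟨_, rfl⟩
  have ha0 : 0 < a := by rw [ha]; positivity
  have hθm := hθbar.1
  have hμp : IsProbabilityMeasure μ := by
    rw [hμ]; exact Measure.isProbabilityMeasure_map measurable_fst.aemeasurable
  have hGp : IsProbabilityMeasure G := by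
    rw [hG]; exact Measure.isProbabilityMeasure_map measurable_snd.aemeasurable
  have hA1' : ∫⁻ p, ENNReal.ofReal (‖p.2‖ ^ 2) ∂P < ⊤ := by
    rw [hG, lintegral_map (by fun_prop) measurable_snd] at hA1
    exact hA1
  obtain ⟨hC, hpy⟩ := aux_pyth P θbar hθbar hA1'
  set C := ∫⁻ p, ENNReal.ofReal (‖θbar p.1 - p.2‖ ^ 2) ∂P
  obtain ⟨OT, hOTd⟩ : ∃ OT, OT = ∫⁻ z, ENNReal.ofReal (‖θbar z - δstar z‖ ^ 2) ∂μ := ⟨_, rfl⟩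
  have hms : Measurable (fun z => (z, δstar z)) := by fun_prop
  have hopt : ∀ π : Measure (Vec d × Vec m), IsCoupling π μ G →
      OT ≤ ∫⁻ p, ENNReal.ofReal (‖θbar p.1 - p.2‖ ^ 2) ∂π := by
    intro π hπ
    have := hδmin π hπ
    rw [lintegral_map (by fun_prop) hms] at this
    rw [hOTd]; exact this
  have hOT : OT ≠ ⊤ := ((hopt P ⟨hμ.symm, hG.symm⟩).trans_lt hC).ne
  have hobj : ∀ δ : Vec d → Vec m, Measurable δ →
      ∫⁻ p, ENNReal.ofReal (‖δ p.1 - p.2‖ ^ 2) ∂P + ENNReal.ofReal (1 / a) * W2sq (μ.map δ) G =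
      (∫⁻ z, ENNReal.ofReal (‖δ z - θbar z‖ ^ 2) ∂μ +
        ENNReal.ofReal (1 / a) * W2sq (μ.map δ) G) + C := by
    intro δ hδ
    rw [hpy δ hδ]
    have : ∫⁻ z, ENNReal.ofReal (‖δ z - θbar z‖ ^ 2) ∂μ =
        ∫⁻ p, ENNReal.ofReal (‖δ p.1 - θbar p.1‖ ^ 2) ∂P := by
      rw [hμ, lintegral_map (by fun_prop) measurable_fst]
    rw [this, add_right_comm]
  rw [← ha]
  set δτ : Vec d → Vec m := fun z => (a / (1 + a)) • θbar z + (1 / (1 + a)) • δstar z with hδτ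
  have hδτm : Measurable δτ := by fun_prop
  have hτobj := hobj δτ hδτm
  have hlow : ∀ δ : Vec d → Vec m, Measurable δ → ENNReal.ofReal (1 / (1 + a)) * OT ≤
      ∫⁻ z, ENNReal.ofReal (‖δ z - θbar z‖ ^ 2) ∂μ +
        ENNReal.ofReal (1 / a) * W2sq (μ.map δ) G := by
    intro δ hδ
    refine le_of_forall_gt fun r hr => ?_
    obtain ⟨π, hπ, hlt⟩ := (aux_obj μ G θbar δ hθm hδ a ha0).2 r hr
    refine lt_of_le_of_lt ?_ hlt
    exact (mul_le_mul_right (hopt π hπ) _).trans le_add_self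
  have hup : ∫⁻ z, ENNReal.ofReal (‖δτ z - θbar z‖ ^ 2) ∂μ +
        ENNReal.ofReal (1 / a) * W2sq (μ.map δτ) G ≤ ENNReal.ofReal (1 / (1 + a)) * OT := by
    have hcoup : IsCoupling (μ.map fun z => (z, δstar z)) μ G := by
      constructor
      · rw [Measure.map_map measurable_fst hms]; exact Measure.map_id
      · rw [Measure.map_map measurable_snd hms]; exact hδpush
    refine ((aux_obj μ G θbar δτ hθm hδτm a ha0).1 _ hcoup).trans ?_
    rw [lintegral_map (by fun_prop) hms, lintegral_map (by fun_prop) hms, ← hOTd]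
    have : ∀ z, (1 + a) • δτ z - a • θbar z - δstar z = 0 := by
      intro z
      simp only [hδτ, smul_add, smul_smul]
      rw [mul_div_cancel₀ _ (by positivity), mul_one_div_cancel (by positivity)]
      module
    simp [this]
  have hval := le_antisymm hup (hlow δτ hδτm)
  constructor
  · intro δ hδ
    refine hτobj.le.trans ?_
    rw [hobj δ hδ, hval]
    gcongr
    exact hlow δ hδ
  · intro δ hδ heq
    have heq' := (hobj δ hδ).symm.trans (heq.trans hτobj)
    rw [hval, ENNReal.add_left_inj hC.ne] at heq'
    have hkOT : ENNReal.ofReal (1 / (1 + a)) * OT ≠ ⊤ :=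
      ENNReal.mul_ne_top ENNReal.ofReal_ne_top hOT
    set T : Vec d → Vec m := fun z => (1 + a) • δ z - a • θbar z with hT
    have hTm : Measurable T := by fun_prop
    have k0 : ENNReal.ofReal (1 / (1 + a)) ≠ 0 := by
      simp only [ne_eq, ENNReal.ofReal_eq_zero, not_le]; positivity
    have k1 : ENNReal.ofReal (1 / (a * (1 + a))) ≠ 0 := by
      simp only [ne_eq, ENNReal.ofReal_eq_zero, not_le]; positivity
    have happ : ∀ ε : ℝ≥0∞, ε ≠ 0 → ∃ π : Measure (Vec d × Vec m), IsCoupling π μ G ∧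
        ∫⁻ p, ENNReal.ofReal (‖T p.1 - p.2‖ ^ 2) ∂π ≤ ε ∧
        ∫⁻ p, ENNReal.ofReal (‖θbar p.1 - p.2‖ ^ 2) ∂π ≤ OT + ε := by
      intro ε hε
      set e := min (ENNReal.ofReal (1 / (a * (1 + a))) * ε) (ENNReal.ofReal (1 / (1 + a)) * ε)
        with he
      have he0 : e ≠ 0 := by
        rw [he]
        rcases min_choice (ENNReal.ofReal (1 / (a * (1 + a))) * ε)
          (ENNReal.ofReal (1 / (1 + a)) * ε) with h | h <;> rw [h]
        · exact mul_ne_zero k1 hε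
        · exact mul_ne_zero k0 hε
      obtain ⟨π, hπ, hlt⟩ := (aux_obj μ G θbar δ hθm hδ a ha0).2
        (ENNReal.ofReal (1 / (1 + a)) * OT + e) (by
          rw [heq']; exact ENNReal.lt_add_right hkOT he0)
      refine ⟨π, hπ, ?_, ?_⟩
      · have h1 : ENNReal.ofReal (1 / (a * (1 + a))) *
            ∫⁻ p, ENNReal.ofReal (‖T p.1 - p.2‖ ^ 2) ∂π + ENNReal.ofReal (1 / (1 + a)) * OT ≤
            ENNReal.ofReal (1 / (a * (1 + a))) * ε + ENNReal.ofReal (1 / (1 + a)) * OT := by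
          calc _ ≤ _ := add_le_add_right (mul_le_mul_right (hopt π hπ) _) _
            _ ≤ _ := hlt.le
            _ = e + ENNReal.ofReal (1 / (1 + a)) * OT := add_comm _ _
            _ ≤ _ := add_le_add_left (min_le_left _ _) _
        have h2 := (ENNReal.add_le_add_iff_right hkOT).1 h1
        exact (ENNReal.mul_le_mul_iff_right k1 ENNReal.ofReal_ne_top).1 h2
      · refine (ENNReal.mul_le_mul_iff_right k0 ENNReal.ofReal_ne_top).1 ?_
        rw [mul_add]
        exact (le_add_self.trans hlt.le).trans (add_le_add_right (min_le_right _ _) _)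
    have hTG : μ.map T = G := aux_lim μ G T hTm fun ε hε => by
      obtain ⟨π, h1, h2, _⟩ := happ ε hε
      exact ⟨π, h1, h2⟩
    have hTc := aux_close μ G θbar T hθm hTm OT hOT happ
    have := aux_unique μ G θbar hθm hA2 T δstar hTm hδmeas hTG hδpush OT hOT hTc hOTd.symm.le hopt
    filter_upwards [this] with z hz
    simp only [hδτ]
    rw [← hz, hT]
    simp only [smul_sub, smul_smul]
    rw [one_div_mul_cancel (by positivity), one_div_mul_eq_div]
    module

end
end

section
/- Let μ be a Borel probability measure on ℝ^d, G* a Borel probability measure on ℝ^m, θ̄ : ℝ^d → ℝ^m and T : ℝ^m → ℝ^m Borel measurable maps, and π₀ ∈ Γ(μ, G*). If the pushforward of π₀ under the map (z, ϑ) ↦ (θ̄(z), ϑ) equals (Id × T)♯(θ̄♯μ), then the conditional distribution of ϑ given z under π₀ is the Dirac mass at T(θ̄(z)) for μ-a.e. z; in particular π₀ = (Id × (T ∘ θ̄))♯μ. -/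
open MeasureTheory ProbabilityTheory Filter RealInnerProductSpace
open scoped ENNReal

noncomputable section

/-- If `π₀ ∈ Γ(μ, G*)` and the pushforward of `π₀` by
`(z, ϑ) ↦ (θ̄(z), ϑ)` equals `(Id × T)♯(θ̄♯μ)`, then the conditional distribution of `ϑ`
given `z` under `π₀` is the Dirac mass at `T(θ̄(z))` for `μ`-a.e. `z`; in particular
`π₀ = (Id × (T ∘ θ̄))♯μ`. -/
theorem stmt11 {d m : ℕ}
    (μ : Measure (Vec d)) [IsProbabilityMeasure μ]
    (G : Measure (Vec m)) [IsProbabilityMeasure G]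
    (θbar : Vec d → Vec m) (hθbar_meas : Measurable θbar)
    (T : Vec m → Vec m) (hT_meas : Measurable T)
    (π₀ : Measure (Vec d × Vec m)) [IsProbabilityMeasure π₀]
    (hπ₀ : IsCoupling π₀ μ G)
    (hpush : π₀.map (fun p => (θbar p.1, p.2)) = (μ.map θbar).map fun y => (y, T y)) :
    (∀ᵐ z ∂μ, π₀.condKernel z = Measure.dirac (T (θbar z))) ∧
    π₀ = μ.map fun z => (z, T (θbar z)) := by
  have hE : MeasurableSet {q : Vec m × Vec m | q.2 = T q.1} :=
    measurableSet_eq_fun measurable_snd (hT_meas.comp measurable_fst)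
  have hgraph : Measurable (fun y : Vec m => (y, T y)) := measurable_id.prodMk hT_meas
  have hmap : Measurable (fun p : Vec d × Vec m => (θbar p.1, p.2)) :=
    (hθbar_meas.comp measurable_fst).prodMk measurable_snd
  have h1 : ∀ᵐ q ∂(π₀.map (fun p => (θbar p.1, p.2))), q.2 = T q.1 := by
    rw [hpush]
    exact (ae_map_iff hgraph.aemeasurable hE).2 (Eventually.of_forall fun y => rfl)
  have h2 : ∀ᵐ p ∂π₀, p.2 = T (θbar p.1) := (ae_map_iff hmap.aemeasurable hE).1 h1
  have hTθ : Measurable (fun z => T (θbar z)) := hT_meas.comp hθbar_meas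
  have hg : Measurable (fun z => (z, T (θbar z))) := measurable_id.prodMk hTθ
  have h3 : π₀ = μ.map fun z => (z, T (θbar z)) := by
    rw [← hπ₀.1, Measure.map_map hg measurable_fst]
    conv_lhs => rw [← Measure.map_id (μ := π₀)]
    refine Measure.map_congr ?_
    filter_upwards [h2] with p hp
    exact Prod.ext rfl hp
  refine ⟨?_, h3⟩
  have hfst : π₀.fst = μ := hπ₀.1
  have h4 := eq_condKernel_of_measure_eq_compProd (ρ := π₀)
    (Kernel.deterministic (fun z => T (θbar z)) hTθ)
    (by rw [hfst, Measure.compProd_deterministic]; exact h3)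
  rw [hfst] at h4
  filter_upwards [h4] with z hz
  rw [← hz, Kernel.deterministic_apply]

end
end
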